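/- arXiv:1709.08356 — 2 statements merged into one kernel-verified Lean document; each statement's English description precedes it below -/
import Mathlib

section
/- Let K be a totally real number field in which 2 is totally ramified. Suppose that the class number of K is 1 and that every totally positive unit of O_K is a square in O_K (equivalently, the narrow class number of K is 1). Then the natural reduction homomorphism from the unit group O_Kˣ to the unit group (O_K/4O_K)ˣ is surjective. -/
open NumberField

theorem two_pow_finrank_succ_le_index_two {M : Type*} [AddCommGroup M] [Module.Finite ℤ M]
    {t : M} (ht : t ≠ 0) (ht2 : 2 • t = 0) (hfin : (nsmulAddMonoidHom 2 : M →+ M).range.index ≠ 0) :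
    2 ^ (Module.finrank ℤ M + 1) ≤ (nsmulAddMonoidHom 2 : M →+ M).range.index := by
  let T := Submodule.torsion ℤ M
  let b := Module.finBasis ℤ (M ⧸ T)
  have hrank : Module.finrank ℤ (M ⧸ T) = Module.finrank ℤ M :=
    finrank_quotient_eq_of_le_torsion le_rfl
  let π : M →+ (Fin (Module.finrank ℤ (M ⧸ T)) → ZMod 2) :=
    ((Int.castAddHom (ZMod 2)).compLeft _).comp
      ((b.equivFun.toLinearMap.comp T.mkQ).toAddMonoidHom)
  have hπ : Function.Surjective π := by
    refine Function.Surjective.comp (g := fun f : _ → ℤ ↦ fun i ↦ (f i : ZMod 2)) ?_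
      (b.equivFun.surjective.comp T.mkQ_surjective)
    exact ZMod.intCast_surjective.comp_left
  have hcard : π.ker.index = 2 ^ Module.finrank ℤ M := by
    rw [AddSubgroup.index_ker, AddMonoidHom.range_eq_top.mpr hπ, ← hrank]
    simp
  have hle : (nsmulAddMonoidHom 2 : M →+ M).range ≤ π.ker := by
    rintro _ ⟨x, rfl⟩
    rw [AddMonoidHom.mem_ker, nsmulAddMonoidHom_apply, map_nsmul]
    ext i
    simp [CharTwo.two_eq_zero]
  have hTker : ∀ x ∈ T, x ∈ π.ker := by
    intro x hx
    have : T.mkQ x = 0 := by simpa using hx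
    rw [AddMonoidHom.mem_ker]
    ext i
    simp [π, this]
  have hne : (nsmulAddMonoidHom 2 : M →+ M).range.relIndex π.ker ≠ 1 := by
    intro h1
    rw [AddSubgroup.relIndex_eq_one] at h1
    have : Finite T := Module.finite_of_fg_torsion T Submodule.torsion_isTorsion
    have hsurj : Function.Surjective (nsmulAddMonoidHom 2 : T →+ T) := by
      rintro ⟨x, hx⟩
      obtain ⟨y, hy⟩ := h1 (hTker x hx)
      refine ⟨⟨y, ?_⟩, Subtype.ext hy⟩
      rw [Submodule.mem_torsion_iff] at hx ⊢
      obtain ⟨a, ha⟩ := hx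
      refine ⟨a * ⟨2, by simp⟩, ?_⟩
      rw [← ha, ← hy, mul_smul]
      simp [Submonoid.smul_def, two_smul]
    have hinj := Finite.injective_iff_surjective.mpr hsurj
    have htT : t ∈ T := (Submodule.mem_torsion_iff t).mpr ⟨⟨2, by simp⟩, by
      simpa [Submonoid.smul_def, two_smul] using ht2⟩
    have := @hinj ⟨t, htT⟩ 0 (Subtype.ext (by simpa using ht2))
    exact ht (congrArg Subtype.val this)
  have hmul := AddSubgroup.relIndex_mul_index hle
  rw [← hmul] at hfin ⊢
  rw [hcard] at hfin ⊢
  rw [pow_succ']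
  have := left_ne_zero_of_mul hfin
  gcongr
  omega

theorem two_pow_finrank_succ_le_index_sq {B : Type*} [CommGroup B]
    [Module.Finite ℤ (Additive B)] {t : B} (ht : t ≠ 1) (ht2 : t ^ 2 = 1)
    (hfin : (powMonoidHom 2 : B →* B).range.index ≠ 0) :
    2 ^ (Module.finrank ℤ (Additive B) + 1) ≤ (powMonoidHom 2 : B →* B).range.index :=
  two_pow_finrank_succ_le_index_two (M := Additive B) (t := Additive.ofMul t) ht ht2 hfin

theorem neg_one_ne_one_of_charZero {R : Type*} [Ring R] [CharZero R] : (-1 : Rˣ) ≠ 1 := by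
  intro h
  have h1 : (-1 : R) = 1 := by simpa using congrArg Units.val h
  have h2 : ((2 : ℕ) : R) = 0 := by
    rw [← neg_add_cancel (1 : R), h1]
    norm_num
  exact two_ne_zero (Nat.cast_eq_zero.mp h2)

section Quadratic

variable {R S : Type*} [CommRing R] [CommRing S] [IsDomain S] [Algebra R S]

theorem exists_associated_algebraMap [IsPrincipalIdealRing R] (σ : S ≃ₐ[R] S)
    (hσ : ∀ x, σ (σ x) = x)
    (hfix : ∀ x, σ x = x → ∃ r, algebraMap R S r = x) (h2 : (2 : S) ≠ 0)
    {w : Sˣ} (hw : σ w = -w) {θ : S} {s : R} (hθ : 2 * θ = algebraMap R S s + w)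
    {α ε : S} (hα : ε * α = σ α) :
    ∃ a : R, Associated (algebraMap R S a) α := by
  obtain ⟨a, ha⟩ := (IsPrincipalIdealRing.principal
    ((Ideal.span {α}).comap (algebraMap R S))).principal
  have hmem (r : R) : α ∣ algebraMap R S r ↔ a ∣ r := by
    rw [← Ideal.mem_span_singleton, ← Ideal.mem_comap, ha]
    exact Ideal.mem_span_singleton
  have hinv : (w : S) * ↑w⁻¹ = 1 := by simp
  have hσw : σ (↑w⁻¹ : S) = -↑w⁻¹ := by
    have h1 : σ (w : S) * σ (↑w⁻¹ : S) = 1 := by rw [← map_mul]; simp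
    rw [hw] at h1
    apply w.isUnit.mul_left_cancel
    linear_combination -h1 + hinv
  have hσθ : σ θ = θ - w := by
    have h1 := congrArg σ hθ
    simp only [map_mul, map_add, map_ofNat, AlgEquiv.commutes, hw] at h1
    apply mul_left_cancel₀ h2
    linear_combination h1 - hθ
  obtain ⟨q, hq⟩ := hfix ((α - σ α) * ↑w⁻¹) (by
    rw [map_mul, map_sub, hσ, hσw]
    ring)
  obtain ⟨p, hp⟩ := hfix (α - algebraMap R S q * θ) (by
    rw [map_sub, map_mul, AlgEquiv.commutes, hσθ]
    linear_combination (w : S) * hq + (α - σ α) * hinv)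
  have hαq : α ∣ algebraMap R S q := ⟨(1 - ε) * ↑w⁻¹, by rw [hq, ← hα]; ring⟩
  have hαp : α ∣ algebraMap R S p := by
    rw [hp]
    exact dvd_sub dvd_rfl (hαq.mul_right θ)
  refine ⟨a, associated_of_dvd_dvd ?_ ((hmem a).mpr dvd_rfl)⟩
  have : α = algebraMap R S p + algebraMap R S q * θ := by rw [hp]; ring
  rw [this]
  exact dvd_add (map_dvd _ ((hmem p).mp hαp)) ((map_dvd _ ((hmem q).mp hαq)).mul_right θ)

theorem exists_unit_mul_eq_of_mul_eq_one [IsPrincipalIdealRing R] (σ : S ≃ₐ[R] S)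
    (hσ : ∀ x, σ (σ x) = x)
    (hfix : ∀ x, σ x = x → ∃ r, algebraMap R S r = x) (h2 : (2 : S) ≠ 0)
    {w : Sˣ} (hw : σ w = -w) {θ : S} {s : R} (hθ : 2 * θ = algebraMap R S s + w)
    {ε : S} (hε : ε * σ ε = 1) :
    ∃ η : Sˣ, ε * σ η = η := by
  by_cases h : 1 + ε = 0
  · refine ⟨w, ?_⟩
    rw [hw]
    linear_combination - (w : S) * h
  · obtain ⟨a, η, hη⟩ := exists_associated_algebraMap σ hσ hfix h2 hw hθ
      (α := 1 + ε) (ε := σ ε) (by rw [map_add, map_one]; linear_combination hε)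
    refine ⟨η, ?_⟩
    have ha : algebraMap R S a ≠ 0 := by
      intro ha
      rw [ha, zero_mul] at hη
      exact h hη.symm
    have hση := congrArg σ hη
    rw [map_mul, AlgEquiv.commutes, map_add, map_one] at hση
    apply mul_left_cancel₀ ha
    linear_combination ε * hση - hη + hε

theorem index_sq_ker_dvd_relIndex [IsPrincipalIdealRing R] (σ : S ≃ₐ[R] S)
    (hσ : ∀ x, σ (σ x) = x)
    (hfix : ∀ x, σ x = x → ∃ r, algebraMap R S r = x) (h2 : (2 : S) ≠ 0)
    {w : Sˣ} (hw : σ w = -w) {θ : S} {s : R} (hθ : 2 * θ = algebraMap R S s + w)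
    (hinj : Function.Injective (algebraMap R S))
    (N : Sˣ →* Rˣ) (hN : ∀ x : Sˣ, algebraMap R S (N x) = x * σ x) :
    (powMonoidHom 2 : N.ker →* N.ker).range.index ∣
      (powMonoidHom 2 : Rˣ →* Rˣ).range.relIndex N.range := by
  let σu : Sˣ →* Sˣ := Units.map (σ : S →* S)
  have hσu (x : Sˣ) : ((σu x : Sˣ) : S) = σ x := rfl
  have hmem (x : Sˣ) : x ∈ N.ker ↔ (x : S) * σ x = 1 := by
    rw [MonoidHom.mem_ker, ← hN, ← Units.val_inj, ← hinj.eq_iff]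
    simp
  let δ : Sˣ →* N.ker := (MonoidHom.id Sˣ / σu).codRestrict N.ker (by
    intro x
    rw [hmem, ← hσu, ← Units.val_mul, Units.val_eq_one]
    have : σu (σu x) = x := Units.ext (hσ x)
    simp [this])
  have hδ (x : Sˣ) : ((δ x : N.ker) : Sˣ) = x / σu x := rfl
  have hδsurj : Function.Surjective δ := by
    rintro ⟨ε, hε⟩
    obtain ⟨η, hη⟩ := exists_unit_mul_eq_of_mul_eq_one σ hσ hfix h2 hw hθ ((hmem ε).mp hε)
    refine ⟨η, Subtype.ext ?_⟩
    rw [hδ, div_eq_iff_eq_mul]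
    exact Units.ext hη.symm
  rw [← Subgroup.index_comap, ← Subgroup.index_comap_of_surjective _ hδsurj]
  apply Subgroup.index_dvd_of_le
  rintro x ⟨y, hy⟩
  rw [powMonoidHom_apply] at hy
  let z : Sˣ := Units.map (algebraMap R S : R →* S) y
  have hz : σu z = z := Units.ext (σ.commutes y)
  have hk : (x / z) * σu (x / z) = 1 := by
    have h1 : x * σu x = z ^ 2 := by
      apply Units.ext
      rw [Units.val_mul, hσu, ← hN, ← hy]
      simp [z]
    rw [map_div, hz, div_mul_div_comm, h1, sq, div_self']
  refine ⟨⟨x / z, (hmem _).mpr ?_⟩, Subtype.ext ?_⟩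
  · rw [← hσu, ← Units.val_mul, hk, Units.val_one]
  · rw [hδ, powMonoidHom_apply, Subgroup.coe_pow]
    change (x / z) ^ 2 = _
    rw [map_div, hz] at hk
    have : x / z = z / σu x := by
      rw [← inv_div (σu x)]
      exact eq_inv_of_mul_eq_one_left hk
    rw [sq]
    nth_rw 2 [this]
    simp

end Quadratic

section UnitSignature

variable (K : Type*) [Field K] [IsTotallyReal K]

/-- The real embedding of a totally real field attached to an infinite place. -/
noncomputable def realEmbedding (v : InfinitePlace K) : K →+* ℝ :=
  InfinitePlace.embedding_of_isReal (IsTotallyReal.isReal v)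

/-- The signs of a unit of a totally real field at all infinite places. -/
noncomputable def unitSignature : (𝓞 K)ˣ →* (InfinitePlace K → SignTypeˣ) :=
  MonoidHom.pi fun v ↦ Units.map <|
    ((signHom : ℝ →*₀ SignType) : ℝ →* SignType).comp
      (((realEmbedding K v).comp (algebraMap (𝓞 K) K) : 𝓞 K →+* ℝ) : 𝓞 K →* ℝ)

variable {K}

theorem unitSignature_apply_eq_one_iff (u : (𝓞 K)ˣ) (v : InfinitePlace K) :
    unitSignature K u v = 1 ↔ 0 < realEmbedding K v (algebraMap (𝓞 K) K u) := by
  rw [← sign_eq_one_iff, ← Units.val_inj]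
  rfl

theorem exists_infinitePlace_realEmbedding_eq (σ : K →+* ℝ) :
    ∃ v, realEmbedding K v = σ := by
  have hσ : ComplexEmbedding.IsReal (Complex.ofRealHom.comp σ) := by
    rw [ComplexEmbedding.isReal_iff]
    ext x
    simp
  refine ⟨.mk (Complex.ofRealHom.comp σ), RingHom.ext fun x ↦ ?_⟩
  apply Complex.ofReal_injective
  rw [realEmbedding, InfinitePlace.embedding_of_isReal_apply,
    InfinitePlace.embedding_mk_eq_of_isReal hσ]
  rfl

theorem ker_unitSignature
    (hpos : ∀ u : (𝓞 K)ˣ,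
      (∀ σ : K →+* ℝ, 0 < σ (algebraMap (𝓞 K) K u)) → ∃ w : 𝓞 K, (u : 𝓞 K) = w ^ 2) :
    (unitSignature K).ker = (powMonoidHom 2 : (𝓞 K)ˣ →* (𝓞 K)ˣ).range := by
  ext u
  rw [MonoidHom.mem_ker]
  constructor
  · intro hu
    obtain ⟨w, hw⟩ := hpos u fun σ ↦ by
      obtain ⟨v, rfl⟩ := exists_infinitePlace_realEmbedding_eq σ
      rw [← unitSignature_apply_eq_one_iff, hu, Pi.one_apply]
    have hwu : IsUnit w := (isUnit_pow_iff two_ne_zero).mp (hw ▸ u.isUnit)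
    exact ⟨hwu.unit, Units.ext hw.symm⟩
  · rintro ⟨w, rfl⟩
    ext1 v
    rw [Pi.one_apply, unitSignature_apply_eq_one_iff, powMonoidHom_apply, Units.val_pow_eq_pow_val,
      map_pow, map_pow]
    apply sq_pos_of_ne_zero
    simp

variable [NumberField K]

theorem card_infinitePlace_eq_finrank :
    Fintype.card (InfinitePlace K) = Module.finrank ℚ K := by
  rw [InfinitePlace.card_eq_nrRealPlaces_add_nrComplexPlaces, IsTotallyReal.finrank,
    IsTotallyReal.nrComplexPlaces_eq_zero, add_zero]

/-- If every totally positive unit is a square, then units realise all signatures, and the units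
modulo squares have order `2 ^ [K : ℚ]`. -/
theorem unitSignature_surjective_and_index_sq
    (hker : (unitSignature K).ker = (powMonoidHom 2 : (𝓞 K)ˣ →* (𝓞 K)ˣ).range) :
    Function.Surjective (unitSignature K) ∧
      (powMonoidHom 2 : (𝓞 K)ˣ →* (𝓞 K)ˣ).range.index = 2 ^ Module.finrank ℚ K := by
  have hcard : Nat.card (InfinitePlace K → SignTypeˣ) = 2 ^ Module.finrank ℚ K := by
    rw [Nat.card_fun, Nat.card_eq_fintype_card, Nat.card_eq_fintype_card,
      card_infinitePlace_eq_finrank]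
    rfl
  have hidx := Subgroup.index_ker (unitSignature K)
  rw [hker] at hidx
  have hle : Nat.card (unitSignature K).range ≤ 2 ^ Module.finrank ℚ K :=
    hcard ▸ Subgroup.card_le_card_group _
  have hge : 2 ^ Module.finrank ℚ K ≤ (powMonoidHom 2 : (𝓞 K)ˣ →* (𝓞 K)ˣ).range.index := by
    have h := two_pow_finrank_succ_le_index_sq (neg_one_ne_one_of_charZero (R := 𝓞 K)) (by simp) (hidx ▸ Nat.card_pos.ne')
    have hpos : 0 < Fintype.card (InfinitePlace K) := Fintype.card_pos
    rwa [Units.finrank_eq, Units.rank, Nat.sub_add_cancel hpos,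
      card_infinitePlace_eq_finrank] at h
  refine ⟨?_, by omega⟩
  rw [← MonoidHom.range_eq_top]
  exact Subgroup.eq_top_of_card_eq _ (by omega)

end UnitSignature

section QuadraticExtension

variable {K L : Type*} [Field K] [Field L]

theorem finrank_units_le_add_finrank_ker [NumberField K] [NumberField L]
    (N : (𝓞 L)ˣ →* (𝓞 K)ˣ) :
    Module.Finite ℤ (Additive N.ker) ∧
      Units.rank L ≤ Units.rank K + Module.finrank ℤ (Additive N.ker) := by
  let f : Additive (𝓞 L)ˣ →ₗ[ℤ] Additive (𝓞 K)ˣ := N.toAdditive.toIntLinearMap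
  let e : Additive N.ker ≃ₗ[ℤ] LinearMap.ker f :=
    AddEquiv.toIntLinearEquiv
      { toFun := fun x ↦ ⟨Additive.ofMul (x.toMul : (𝓞 L)ˣ), x.toMul.2⟩
        invFun := fun x ↦ Additive.ofMul ⟨x.1.toMul, x.2⟩
        left_inv := fun _ ↦ rfl
        right_inv := fun _ ↦ rfl
        map_add' := fun _ _ ↦ rfl }
  refine ⟨Module.Finite.equiv e.symm, ?_⟩
  rw [e.finrank_eq, ← Units.finrank_eq, ← Units.finrank_eq,
    ← Submodule.finrank_quotient_add_finrank (LinearMap.ker f), f.quotKerEquivRange.finrank_eq]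
  gcongr
  exact Submodule.finrank_le _

variable [IsTotallyReal K] [Algebra K L] [IsGalois K L]

theorem realEmbedding_pos_of_not_isUnramifiedIn {σ : Gal(L/K)} (hgal : ∀ τ, τ = 1 ∨ τ = σ)
    {v : InfinitePlace K} (hv : ¬ v.IsUnramifiedIn L) {x : L} (hx : x ≠ 0) {y : K}
    (hy : algebraMap K L y = x * σ x) : 0 < realEmbedding K v y := by
  simp only [InfinitePlace.IsUnramifiedIn, not_forall] at hv
  obtain ⟨w, rfl, hw⟩ := hv
  have hw' : w.IsRamified K := hw
  obtain ⟨τ, hτ⟩ := InfinitePlace.exists_isConj_of_isRamified (φ := w.embedding)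
    (by rwa [InfinitePlace.mk_embedding])
  have hτσ : τ = σ := (hgal τ).resolve_left <|
    (ComplexEmbedding.isConj_ne_one_iff hτ).mpr (InfinitePlace.isComplex_iff.mp hw'.isComplex)
  subst hτσ
  have h : ((realEmbedding K (w.comap (algebraMap K L)) y : ℝ) : ℂ) =
      (Complex.normSq (w.embedding x) : ℂ) := by
    rw [realEmbedding, InfinitePlace.embedding_of_isReal_apply,
      InfinitePlace.comap_embedding_of_isReal _ (IsTotallyReal.isReal _), RingHom.comp_apply, hy,
      map_mul, hτ.eq, ← Complex.mul_conj]
    rfl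
  rw [Complex.ofReal_injective h, Complex.normSq_pos]
  simpa using hx

open scoped Classical in
/-- If `K` has class number one and its totally positive units are squares, then there is no
quadratic extension of the form `K(w)` with `w` a unit of trace zero and `(s + w) / 2` integral
(which would be unramified at all finite primes). -/
theorem false_of_quadratic_of_unramified [NumberField K] [NumberField L]
    [IsPrincipalIdealRing (𝓞 K)]
    (hker : (unitSignature K).ker = (powMonoidHom 2 : (𝓞 K)ˣ →* (𝓞 K)ˣ).range)
    (hdeg : Module.finrank K L = 2) (σ : Gal(L/K)) {w : (𝓞 L)ˣ} (hw : σ (w : 𝓞 L) = -(w : 𝓞 L))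
    {θ : 𝓞 L} {s : 𝓞 K} (hθ : 2 * θ = algebraMap (𝓞 K) (𝓞 L) s + w) : False := by
  have hfd : FiniteDimensional K L := Module.finite_of_finrank_pos (by omega)
  have hw0 : ((w : 𝓞 L) : L) ≠ 0 := by simp
  have hσ1 : (1 : Gal(L/K)) ≠ σ := by
    rintro rfl
    exact hw0 (self_eq_neg.mp hw)
  have huniv : (Finset.univ : Finset Gal(L/K)) = {1, σ} := by
    refine (Finset.eq_of_subset_of_card_le (Finset.subset_univ _) ?_).symm
    rw [Finset.card_univ, ← Nat.card_eq_fintype_card, IsGalois.card_aut_eq_finrank, hdeg,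
      Finset.card_pair hσ1]
  have hgal (τ : Gal(L/K)) : τ = 1 ∨ τ = σ := by simpa [huniv] using Finset.mem_univ τ
  have hσσ : σ * σ = 1 := (hgal (σ * σ)).resolve_right fun h ↦ hσ1 (mul_eq_left.mp h).symm
  let σ' : 𝓞 L ≃ₐ[𝓞 K] 𝓞 L := RingOfIntegers.mapAlgEquiv σ
  have hσ' (x : 𝓞 L) : ((σ' x : 𝓞 L) : L) = σ x := rfl
  let N : (𝓞 L)ˣ →* (𝓞 K)ˣ := Units.map (RingOfIntegers.norm K)
  have hN (x : (𝓞 L)ˣ) : algebraMap (𝓞 K) (𝓞 L) (N x) = x * σ' x := by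
    apply RingOfIntegers.ext
    rw [Units.coe_map, RingOfIntegers.coe_algebraMap_norm,
      Algebra.norm_eq_prod_automorphisms, huniv, Finset.prod_pair hσ1]
    rfl
  have hfix (x : 𝓞 L) (hx : σ' x = x) : ∃ r, algebraMap (𝓞 K) (𝓞 L) r = x := by
    obtain ⟨y, hy⟩ := (IsGalois.mem_range_algebraMap_iff_fixed (F := K) (x : L)).mpr (by
      intro τ
      obtain rfl | rfl := hgal τ
      · rfl
      · rw [← hσ', hx])
    have hyint : IsIntegral ℤ y := by
      rw [← isIntegral_algebraMap_iff (algebraMap K L).injective, hy]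
      exact x.isIntegral_coe
    exact ⟨⟨y, hyint⟩, RingOfIntegers.ext hy⟩
  have hdvd := index_sq_ker_dvd_relIndex σ' (fun x ↦ RingOfIntegers.ext (DFunLike.congr_fun hσσ _))
    hfix two_ne_zero (w := w) (RingOfIntegers.ext hw) hθ
    (FaithfulSMul.algebraMap_injective _ _) N hN
  obtain ⟨hsurj, hindex⟩ := unitSignature_surjective_and_index_sq hker
  -- squares are norms
  have hle : (powMonoidHom 2 : (𝓞 K)ˣ →* (𝓞 K)ˣ).range ≤ N.range := by
    rintro _ ⟨x, rfl⟩
    refine ⟨Units.map (algebraMap (𝓞 K) (𝓞 L) : 𝓞 K →* 𝓞 L) x, Units.ext ?_⟩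
    simp [N, RingOfIntegers.norm_algebraMap, hdeg]
  have hmul := Subgroup.relIndex_mul_index hle
  rw [hindex] at hmul
  have hpow : 2 ^ Module.finrank ℚ K ≠ 0 := by positivity
  -- norms are positive at the ramified infinite places
  let ρ : (𝓞 K)ˣ →* ({v : InfinitePlace K // ¬ v.IsUnramifiedIn L} → SignTypeˣ) :=
    MonoidHom.pi fun v ↦ (Pi.evalMonoidHom _ v.1).comp (unitSignature K)
  have hρ : Function.Surjective ρ := by
    intro f
    obtain ⟨u, hu⟩ := hsurj fun v ↦ if h : ¬ v.IsUnramifiedIn L then f ⟨v, h⟩ else 1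
    refine ⟨u, funext fun v ↦ ?_⟩
    change unitSignature K u v.1 = f v
    simp [hu, v.2]
  have hρindex : ρ.ker.index = 2 ^ Fintype.card {v : InfinitePlace K // ¬ v.IsUnramifiedIn L} := by
    rw [Subgroup.index_ker, MonoidHom.range_eq_top.mpr hρ, Subgroup.card_top, Nat.card_fun,
      Nat.card_eq_fintype_card, Nat.card_eq_fintype_card]
    rfl
  have hNρ : N.range ≤ ρ.ker := by
    rintro _ ⟨x, rfl⟩
    rw [MonoidHom.mem_ker]
    ext1 v
    refine (unitSignature_apply_eq_one_iff _ _).mpr ?_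
    exact realEmbedding_pos_of_not_isUnramifiedIn hgal v.2 (x := (x : 𝓞 L)) (by simp)
      (congrArg (algebraMap (𝓞 L) L) (hN x))
  have hNge := Nat.le_of_dvd (Nat.pos_of_ne_zero (right_ne_zero_of_mul (hmul ▸ hpow)))
    (Subgroup.index_dvd_of_le hNρ)
  rw [hρindex] at hNge
  -- the units of norm one
  have hrel0 := left_ne_zero_of_mul (hmul ▸ hpow)
  obtain ⟨hfg, hrank⟩ := finrank_units_le_add_finrank_ker N
  have hB := two_pow_finrank_succ_le_index_sq (B := N.ker)
    (t := ⟨-1, by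
      rw [MonoidHom.mem_ker, ← Units.val_inj,
        ← (FaithfulSMul.algebraMap_injective (𝓞 K) (𝓞 L)).eq_iff, hN]
      simp⟩)
    (by
      rw [Ne, ← Subtype.val_inj]
      exact neg_one_ne_one_of_charZero)
    (Subtype.ext (by simp)) (ne_zero_of_dvd_ne_zero hrel0 hdvd)
  have hBle := hB.trans (Nat.le_of_dvd (Nat.pos_of_ne_zero hrel0) hdvd)
  have hplaces := InfinitePlace.card_eq_card_isUnramifiedIn (k := K) (K := L)
  have hcompl := Finset.card_add_card_compl ({v : InfinitePlace K | v.IsUnramifiedIn L} : Finset _)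
  have hcompl' : Fintype.card {v : InfinitePlace K // ¬ v.IsUnramifiedIn L} =
      ({v : InfinitePlace K | v.IsUnramifiedIn L} : Finset _)ᶜ.card := by
    rw [Fintype.card_subtype, Finset.compl_filter]
  rw [hdeg] at hplaces
  have hKpos : 0 < Fintype.card (InfinitePlace K) := Fintype.card_pos
  rw [Units.rank, Units.rank] at hrank
  have h := Nat.mul_le_mul hBle hNge
  rw [hmul, ← pow_add, Nat.pow_le_pow_iff_right (by norm_num),
    ← card_infinitePlace_eq_finrank] at h
  omega

end QuadraticExtension

theorem exists_algebraMap_eq_of_sq_eq {R F : Type*} [CommRing R] [IsDomain R] [Field F]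
    [Algebra R F] [IsFractionRing R F] [IsIntegrallyClosed R] {s t : R} {x : F}
    (hx : x ^ 2 = algebraMap R F s * x + algebraMap R F t) : ∃ y, algebraMap R F y = x := by
  rw [← IsIntegrallyClosed.isIntegral_iff]
  refine ⟨(.X ^ 2 - (.C s * .X + .C t) : Polynomial R), Polynomial.monic_X_pow_sub ?_, ?_⟩
  · exact Polynomial.degree_linear_lt
  · simp [hx]

section UnitsModFour

variable {K : Type*} [Field K] [NumberField K]

theorem exists_eq_one_add_two_mul_of_four_dvd {a : 𝓞 K} (ha : 4 ∣ a ^ 2 - 1) :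
    ∃ y, a = 1 + 2 * y := by
  obtain ⟨t, ht⟩ := ha
  obtain ⟨y, hy⟩ := exists_algebraMap_eq_of_sq_eq (R := 𝓞 K) (F := K) (s := -1) (t := t)
    (x := ((a : K) - 1) / 2) (by
      have h := congrArg (algebraMap (𝓞 K) K) ht
      simp only [map_sub, map_pow, map_one, map_mul, map_ofNat] at h
      simp only [map_neg, map_one]
      linear_combination h / 4)
  refine ⟨y, RingOfIntegers.ext ?_⟩
  simp only [map_add, map_mul, map_one, map_ofNat, hy]
  ring

theorem exists_sq_eq_of_four_dvd_sub_sq [IsTotallyReal K] [IsPrincipalIdealRing (𝓞 K)]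
    (hker : (unitSignature K).ker = (powMonoidHom 2 : (𝓞 K)ˣ →* (𝓞 K)ˣ).range)
    {u : (𝓞 K)ˣ} {s : 𝓞 K} (hus : 4 ∣ (u : 𝓞 K) - s ^ 2) :
    ∃ v : (𝓞 K)ˣ, v ^ 2 = u := by
  by_contra! hu
  have hirr : Irreducible (.X ^ 2 - .C ((u : 𝓞 K) : K) : Polynomial K) := by
    refine X_pow_sub_C_irreducible_of_prime Nat.prime_two fun b hb ↦ ?_
    obtain ⟨y, rfl⟩ := exists_algebraMap_eq_of_sq_eq (R := 𝓞 K) (s := 0) (t := u) (x := b)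
      (by simpa using hb)
    have hy : y ^ 2 = u := RingOfIntegers.ext (by simpa using hb)
    have hyu : IsUnit y := (isUnit_pow_iff two_ne_zero).mp (hy ▸ u.isUnit)
    exact hu hyu.unit (Units.ext hy)
  have : Fact (Irreducible (.X ^ 2 - .C ((u : 𝓞 K) : K) : Polynomial K)) := ⟨hirr⟩
  let L := AdjoinRoot (.X ^ 2 - .C ((u : 𝓞 K) : K) : Polynomial K)
  let pb := AdjoinRoot.powerBasis hirr.ne_zero
  have hdeg : Module.finrank K L = 2 := by
    rw [pb.finrank, AdjoinRoot.powerBasis_dim, Polynomial.natDegree_X_pow_sub_C]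
  have : Module.Finite K L := pb.finite
  have : NumberField L := NumberField.of_module_finite K L
  have : Algebra.IsQuadraticExtension K L := ⟨hdeg⟩
  let r : L := AdjoinRoot.root _
  have hr : r ^ 2 = algebraMap K L ((u : 𝓞 K) : K) := by
    have h := AdjoinRoot.eval₂_root (.X ^ 2 - .C ((u : 𝓞 K) : K) : Polynomial K)
    rw [Polynomial.eval₂_sub, Polynomial.eval₂_X_pow, Polynomial.eval₂_C] at h
    exact sub_eq_zero.mp h
  have hcard : Nat.card Gal(L/K) = 2 := by rw [IsGalois.card_aut_eq_finrank, hdeg]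
  obtain ⟨σ, hσ⟩ : ∃ σ : Gal(L/K), σ ≠ 1 := by
    by_contra! h
    have : Subsingleton Gal(L/K) := ⟨fun a b ↦ (h a).trans (h b).symm⟩
    have := Nat.card_of_subsingleton (1 : Gal(L/K))
    omega
  have hσr : σ r = -r := by
    refine (sq_eq_sq_iff_eq_or_eq_neg.mp ?_).resolve_left fun h ↦ hσ ?_
    · rw [← map_pow, hr, AlgEquiv.commutes]
    · ext x
      exact DFunLike.congr_fun (AdjoinRoot.algHom_ext (g₁ := (σ : L →ₐ[K] L)) (g₂ := .id K L) h) x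
  obtain ⟨w, hw⟩ := exists_algebraMap_eq_of_sq_eq (R := 𝓞 L) (s := 0)
    (t := algebraMap (𝓞 K) (𝓞 L) u) (x := r) (by
      rw [hr, map_zero, zero_mul, zero_add]
      rfl)
  have hw2 : w ^ 2 = algebraMap (𝓞 K) (𝓞 L) u := RingOfIntegers.coe_injective (by
    rw [map_pow, hw, hr]
    rfl)
  have hwu : IsUnit w := (isUnit_pow_iff two_ne_zero).mp (hw2 ▸ u.isUnit.map _)
  obtain ⟨t, ht⟩ := hus
  have ht' := congrArg (algebraMap (𝓞 K) (𝓞 L)) ht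
  simp only [map_sub, map_pow, map_mul, map_ofNat, ← hw2] at ht'
  have ht'' := congrArg (algebraMap (𝓞 L) L) ht'
  simp only [map_sub, map_pow, map_mul, map_ofNat] at ht''
  obtain ⟨θ, hθ⟩ := exists_algebraMap_eq_of_sq_eq (R := 𝓞 L)
    (s := algebraMap (𝓞 K) (𝓞 L) s) (t := algebraMap (𝓞 K) (𝓞 L) t)
    (x := (algebraMap (𝓞 L) L (algebraMap (𝓞 K) (𝓞 L) s) + algebraMap (𝓞 L) L w) / 2) (by
      linear_combination ht'' / 4)
  refine false_of_quadratic_of_unramified (L := L) hker hdeg σ (w := hwu.unit) (θ := θ) (s := s)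
    ?_ (RingOfIntegers.coe_injective ?_)
  · rw [IsUnit.unit_spec]
    change σ (algebraMap (𝓞 L) L w) = - algebraMap (𝓞 L) L w
    rw [hw, hσr]
  · rw [map_mul, hθ, map_add, map_ofNat, IsUnit.unit_spec]
    ring

theorem card_quotient_span_two :
    Nat.card (𝓞 K ⧸ Ideal.span {(2 : 𝓞 K)}) = 2 ^ Module.finrank ℚ K := by
  have h := Ideal.absNorm_span_singleton (2 : 𝓞 K)
  rw [Ideal.absNorm_apply, Submodule.cardQuot_apply] at h
  rw [h, ← map_ofNat (algebraMap ℤ (𝓞 K)) 2, Algebra.norm_algebraMap, RingOfIntegers.rank,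
    Int.natAbs_pow]
  rfl

instance finite_quotient_span_four : Finite (𝓞 K ⧸ Ideal.span {(4 : 𝓞 K)}) :=
  Ring.HasFiniteQuotients.finiteQuotient (by simp)

theorem index_sq_units_quotient_four_le :
    (powMonoidHom 2 :
      (𝓞 K ⧸ Ideal.span {(4 : 𝓞 K)})ˣ →* (𝓞 K ⧸ Ideal.span {(4 : 𝓞 K)})ˣ).range.index ≤
      2 ^ Module.finrank ℚ K := by
  rw [Subgroup.index_range, ← card_quotient_span_two]
  have : Finite (𝓞 K ⧸ Ideal.span {(2 : 𝓞 K)}) :=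
    Ring.HasFiniteQuotients.finiteQuotient (by simp)
  have hlift (x : (powMonoidHom 2 : (𝓞 K ⧸ Ideal.span {(4 : 𝓞 K)})ˣ →* _).ker) :
      ∃ y : 𝓞 K, Ideal.Quotient.mk (Ideal.span {(4 : 𝓞 K)}) (1 + 2 * y) = x.1 := by
    obtain ⟨x, hx⟩ := x
    obtain ⟨a, ha⟩ := Ideal.Quotient.mk_surjective (x : 𝓞 K ⧸ Ideal.span {(4 : 𝓞 K)})
    rw [MonoidHom.mem_ker, powMonoidHom_apply, ← Units.val_inj, Units.val_pow_eq_pow_val,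
      ← ha, ← map_pow, Units.val_one, ← map_one (Ideal.Quotient.mk _), Ideal.Quotient.eq,
      Ideal.mem_span_singleton] at hx
    obtain ⟨y, rfl⟩ := exists_eq_one_add_two_mul_of_four_dvd hx
    exact ⟨y, ha⟩
  choose f hf using hlift
  refine Nat.card_le_card_of_injective (fun x ↦ Ideal.Quotient.mk _ (f x)) fun x y hxy ↦ ?_
  rw [Ideal.Quotient.eq, Ideal.mem_span_singleton] at hxy
  obtain ⟨c, hc⟩ := hxy
  rw [← Subtype.val_inj, ← Units.val_inj, ← hf, ← hf, Ideal.Quotient.eq,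
    Ideal.mem_span_singleton]
  exact ⟨c, by linear_combination 2 * hc⟩

theorem units_quotient_four_pow_eq_one (𝓛 : Ideal (𝓞 K)) [𝓛.IsMaximal]
    (hram : Ideal.span {(2 : 𝓞 K)} = 𝓛 ^ (Module.finrank ℚ K))
    (x : (𝓞 K ⧸ Ideal.span {(4 : 𝓞 K)})ˣ) : x ^ 2 ^ (Module.finrank ℚ K + 1) = 1 := by
  have hd : Module.finrank ℚ K ≠ 0 := Module.finrank_pos.ne'
  have hcard : Nat.card (𝓞 K ⧸ 𝓛) = 2 := by
    have h : Ideal.absNorm (Ideal.span {(2 : 𝓞 K)}) = 2 ^ Module.finrank ℚ K :=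
      card_quotient_span_two
    rw [hram, map_pow] at h
    exact Nat.pow_left_injective hd h
  obtain ⟨a, ha⟩ := Ideal.Quotient.mk_surjective (x : 𝓞 K ⧸ Ideal.span {(4 : 𝓞 K)})
  have h2 : (2 : 𝓞 K) ∈ 𝓛 :=
    Ideal.pow_le_self hd (hram ▸ Ideal.mem_span_singleton_self (2 : 𝓞 K))
  have ha𝓛 : a ∉ 𝓛 := by
    intro h
    obtain ⟨b, hb⟩ := Ideal.Quotient.mk_surjective ((x⁻¹ : (_ ⧸ Ideal.span {(4 : 𝓞 K)})ˣ) :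
      𝓞 K ⧸ Ideal.span {(4 : 𝓞 K)})
    have hab : a * b - 1 ∈ Ideal.span {(4 : 𝓞 K)} := by
      rw [← Ideal.Quotient.eq, map_mul, ha, hb, map_one, Units.mul_inv]
    rw [Ideal.mem_span_singleton] at hab
    obtain ⟨c, hc⟩ := hab
    refine (Ideal.ne_top_iff_one 𝓛).mp (Ideal.IsMaximal.ne_top ‹_›) ?_
    have : (1 : 𝓞 K) = b * a - 2 * c * 2 := by linear_combination -hc
    rw [this]
    exact sub_mem (𝓛.mul_mem_left _ h) (𝓛.mul_mem_left _ h2)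
  have ha1 : a - 1 ∈ 𝓛 := by
    rw [← Ideal.Quotient.eq]
    obtain ⟨y, hy, hy'⟩ := (Nat.card_eq_two_iff' (0 : 𝓞 K ⧸ 𝓛)).mp hcard
    rw [hy' (Ideal.Quotient.mk 𝓛 a) (mt Ideal.Quotient.eq_zero_iff_mem.mp ha𝓛),
      hy' (Ideal.Quotient.mk 𝓛 1) (by simp)]
  -- `a ^ 2 ^ k ≡ 1` modulo `2` for large `k`
  have hmod (k : ℕ) : (2 : 𝓞 K) ∣ a ^ 2 ^ k - 1 - (a - 1) ^ 2 ^ k := by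
    induction k with
    | zero => simp
    | succ k ih =>
      obtain ⟨c, hc⟩ := ih
      rw [pow_succ, pow_mul, pow_mul, sub_eq_iff_eq_add.mp (sub_eq_iff_eq_add.mp hc)]
      refine ⟨2 * c ^ 2 + 2 * c + 2 * c * (a - 1) ^ 2 ^ k + (a - 1) ^ 2 ^ k, by ring⟩
  have hpow : (2 : 𝓞 K) ∣ (a - 1) ^ 2 ^ Module.finrank ℚ K := by
    rw [← Ideal.mem_span_singleton, hram]
    exact Ideal.pow_le_pow_right Nat.lt_two_pow_self.le (Ideal.pow_mem_pow ha1 _)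
  obtain ⟨c, hc⟩ := (dvd_sub_left hpow).mp (hmod _)
  rw [← Units.val_inj, Units.val_pow_eq_pow_val, ← ha, ← map_pow, Units.val_one,
    ← map_one (Ideal.Quotient.mk _), Ideal.Quotient.eq, Ideal.mem_span_singleton, pow_succ,
    pow_mul, sub_eq_iff_eq_add.mp hc]
  exact ⟨c ^ 2 + c, by ring⟩

end UnitsModFour

theorem surjective_of_forall_exists_mul_sq {E G : Type*} [CommGroup E] [CommGroup G] (f : E →* G)
    (h : ∀ g, ∃ e y, f e * y ^ 2 = g) {n : ℕ} (hG : ∀ g : G, g ^ 2 ^ n = 1) :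
    Function.Surjective f := by
  have key (k : ℕ) (g : G) : ∃ e y, f e * y ^ 2 ^ k = g := by
    induction k with
    | zero => exact ⟨1, g, by simp⟩
    | succ k ih =>
      obtain ⟨e, y, rfl⟩ := ih
      obtain ⟨e', z, rfl⟩ := h y
      exact ⟨e * e' ^ 2 ^ k, z, by
        rw [map_mul, map_pow, mul_pow, ← pow_mul, ← pow_succ', mul_assoc]⟩
  intro g
  obtain ⟨e, y, rfl⟩ := key n g
  exact ⟨e, by rw [hG, mul_one]⟩

/-- If `f` induces an injection modulo squares and the source has at least as many classes modulo
squares as the target, then `f` is surjective modulo squares. -/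
theorem exists_mul_sq_eq_of_index_le {E G : Type*} [CommGroup E] [CommGroup G] [Finite G]
    (f : E →* G)
    (hinj : (powMonoidHom 2 : G →* G).range.comap f ≤ (powMonoidHom 2 : E →* E).range)
    (hindex : (powMonoidHom 2 : G →* G).range.index ≤ (powMonoidHom 2 : E →* E).range.index)
    (g : G) :
    ∃ e y, f e * y ^ 2 = g := by
  let q := (QuotientGroup.mk' (powMonoidHom 2 : G →* G).range).comp f
  have hq : q.ker = (powMonoidHom 2 : G →* G).range.comap f := by
    rw [← MonoidHom.comap_ker, QuotientGroup.ker_mk']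
  have hle : (powMonoidHom 2 : E →* E).range.index ≤ q.ker.index := by
    refine Nat.le_of_dvd (Nat.pos_of_ne_zero ?_) (Subgroup.index_dvd_of_le (hq ▸ hinj))
    rw [Subgroup.index_ker]
    exact Nat.card_pos.ne'
  have htop : q.range = ⊤ := by
    refine Subgroup.eq_top_of_le_card _ ?_
    rw [← Subgroup.index_ker]
    exact hindex.trans hle
  obtain ⟨e, he⟩ := MonoidHom.range_eq_top.mp htop g
  obtain ⟨y, hy⟩ := QuotientGroup.eq.mp he
  exact ⟨e, y, by rw [← powMonoidHom_apply, hy, mul_inv_cancel_left]⟩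

/-- **Part of Theorem 17 (via Lemma 16) of Kraus' paper.**
Let `K` be a totally real number field in which `2` is totally ramified.  If the class
number of `K` is `1` and every totally positive unit of `𝓞 K` is a square (i.e. the
narrow class number of `K` is `1`), then the reduction map `(𝓞 K)ˣ → (𝓞 K / 4𝓞 K)ˣ`
is surjective. -/
theorem units_map_to_quotient_four_surjective
    (K : Type*) [Field K] [NumberField K]
    (htotreal : ∀ φ : K →+* ℂ, ∀ x : K, (φ x).im = 0)
    (𝓛 : Ideal (𝓞 K)) (h𝓛 : 𝓛.IsMaximal)
    (hram : Ideal.span {(2 : 𝓞 K)} = 𝓛 ^ (Module.finrank ℚ K))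
    (hclass : NumberField.classNumber K = 1)
    (hpos : ∀ u : (𝓞 K)ˣ,
      (∀ σ : K →+* ℝ, 0 < σ (algebraMap (𝓞 K) K u)) → ∃ w : 𝓞 K, (u : 𝓞 K) = w ^ 2) :
    Function.Surjective
      (Units.map (Ideal.Quotient.mk (Ideal.span {(4 : 𝓞 K)})).toMonoidHom :
        (𝓞 K)ˣ → ((𝓞 K) ⧸ Ideal.span {(4 : 𝓞 K)})ˣ) := by
  have : IsTotallyReal K := ⟨fun v ↦ by
    rw [InfinitePlace.isReal_iff, ComplexEmbedding.isReal_iff]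
    ext x
    exact Complex.conj_eq_iff_im.mpr (htotreal _ x)⟩
  have : IsPrincipalIdealRing (𝓞 K) := classNumber_eq_one_iff.mp hclass
  have hker := ker_unitSignature hpos
  have hindex := (unitSignature_surjective_and_index_sq hker).2
  refine surjective_of_forall_exists_mul_sq _ (exists_mul_sq_eq_of_index_le _ ?_ ?_)
    (units_quotient_four_pow_eq_one 𝓛 hram)
  · rintro u ⟨g, hg⟩
    obtain ⟨s, hs⟩ := Ideal.Quotient.mk_surjective (g : 𝓞 K ⧸ Ideal.span {(4 : 𝓞 K)})
    refine exists_sq_eq_of_four_dvd_sub_sq hker (s := s) ?_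
    rw [← Ideal.mem_span_singleton, ← Ideal.Quotient.eq, map_pow, hs]
    exact (congrArg Units.val hg).symm
  · rw [hindex]
    exact index_sq_units_quotient_four_le
end

section
/- Let K be a totally real number field such that the class number of K is 1 and the natural reduction homomorphism from the unit group O_Kˣ to (O_K/4O_K)ˣ is surjective. Then every totally positive unit of O_K is a square in O_K. -/
open NumberField

namespace Valuation

open WithZero

variable {K : Type*} [Field K] (v : Valuation K ℤᵐ⁰)

/-- The additive subgroup of elements of additive valuation at least `k`. -/
def filtration (k : ℤ) : AddSubgroup K where
  carrier := {x | v x ≤ exp (-k)}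
  zero_mem' := by simp
  add_mem' {x y} hx hy := (v.map_add x y).trans (max_le hx hy)
  neg_mem' {x} hx := by simpa [v.map_neg] using hx

variable {v}

theorem mem_filtration {k : ℤ} {x : K} : x ∈ v.filtration k ↔ v x ≤ exp (-k) := Iff.rfl

theorem filtration_anti {k l : ℤ} (h : k ≤ l) {x : K} (hx : x ∈ v.filtration l) :
    x ∈ v.filtration k :=
  le_trans (mem_filtration.1 hx) (exp_le_exp.2 (by lia))

theorem mul_mem_filtration {k l m : ℤ} {x y : K} (hx : x ∈ v.filtration k)
    (hy : y ∈ v.filtration l) (h : m ≤ k + l) : x * y ∈ v.filtration m := by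
  refine filtration_anti h ?_
  rw [mem_filtration, map_mul, neg_add, exp_add]
  exact mul_le_mul' hx hy

theorem exists_mem_filtration (x : K) : ∃ k : ℤ, x ∈ v.filtration k := by
  by_cases hx : v x = 0
  · exact ⟨0, by simp [mem_filtration, hx]⟩
  · exact ⟨-log (v x), by rw [mem_filtration, neg_neg, exp_log hx]⟩

theorem mem_filtration_of_mul_mem {k l m : ℤ} {a x : K} (ha : v a = exp (-m))
    (h : a * x ∈ v.filtration l) (hk : k + m ≤ l) : x ∈ v.filtration k := by
  have h' := filtration_anti hk h
  rw [mem_filtration, map_mul, ha, neg_add, exp_add, mul_comm] at h'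
  exact le_of_mul_le_mul_right h' (by simp)

theorem mem_filtration_of_sq_mem {k l : ℤ} {x : K} (h : x ^ 2 ∈ v.filtration l)
    (hk : 2 * k ≤ l + 1) : x ∈ v.filtration k := by
  by_cases hx : v x = 0
  · simp [mem_filtration, hx]
  · rw [mem_filtration, map_pow, ← log_le_iff_le_exp (pow_ne_zero _ hx), log_pow] at h
    rw [mem_filtration, ← log_le_iff_le_exp hx]
    simp only [nsmul_eq_mul, Nat.cast_ofNat] at h
    lia

theorem mem_filtration_of_eq {k : ℤ} {x : K} (h : v x = exp (-k)) : x ∈ v.filtration k :=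
  h.le

theorem ne_zero_of_eq_exp {k : ℤ} {x : K} (h : v x = exp k) : x ≠ 0 :=
  v.ne_zero_iff.1 (h ▸ exp_ne_zero)

/-- Solutions of a ramified norm congruence close to `1` are close to `1`. -/
theorem mem_filtration_of_ramified_norm {j : ℤ} {q s x y : K} (hq : v q = exp (-1))
    (hs : s ∈ v.filtration j) (h2 : (2 : K) ∈ v.filtration j)
    (h : x ^ 2 + 2 * x + s * y + s * (x * y) - q * y ^ 2 ∈ v.filtration (2 * j - 1))
    (hj : 1 ≤ j) :
    x ∈ v.filtration j ∧ y ∈ v.filtration (j - 1) := by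
  have hx_step {i : ℤ} (hi : i ≤ j - 1) (hx : x ∈ v.filtration i) (hy : y ∈ v.filtration i) :
      x ∈ v.filtration (i + 1) := by
    refine mem_filtration_of_sq_mem (l := 2 * i + 1) ?_ (by lia)
    have e : x ^ 2 = (x ^ 2 + 2 * x + s * y + s * (x * y) - q * y ^ 2) - 2 * x - s * y
      - s * (x * y) + q * (y * y) := by ring
    rw [e]
    have hxy := mul_mem_filtration hx hy le_rfl
    have hyy := mul_mem_filtration hy hy le_rfl
    exact add_mem (sub_mem (sub_mem (sub_mem (filtration_anti (by lia) h)
      (mul_mem_filtration h2 hx (by lia))) (mul_mem_filtration hs hy (by lia)))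
      (mul_mem_filtration hs hxy (by lia)))
      (mul_mem_filtration (mem_filtration_of_eq hq) hyy (by lia))
  have hy_step {i : ℤ} (hi : i ≤ j - 2) (hx : x ∈ v.filtration (i + 1))
      (hy : y ∈ v.filtration i) : y ∈ v.filtration (i + 1) := by
    refine mem_filtration_of_sq_mem (l := 2 * i + 1) ?_ (by lia)
    refine mem_filtration_of_mul_mem (l := 2 * i + 2) hq ?_ (by lia)
    have e : q * y ^ 2 = x * x + 2 * x + s * y + s * (x * y)
      - (x ^ 2 + 2 * x + s * y + s * (x * y) - q * y ^ 2) := by ring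
    rw [e]
    have hxy := mul_mem_filtration hx hy le_rfl
    exact sub_mem (add_mem (add_mem (add_mem (mul_mem_filtration hx hx (by lia))
      (mul_mem_filtration h2 hx (by lia))) (mul_mem_filtration hs hy (by lia)))
      (mul_mem_filtration hs hxy (by lia))) (filtration_anti (by lia) h)
  obtain ⟨a, ha⟩ := exists_mem_filtration (v := v) x
  obtain ⟨b, hb⟩ := exists_mem_filtration (v := v) y
  have key (n : ℕ) : x ∈ v.filtration (min (min a b + n) (j - 1)) ∧
      y ∈ v.filtration (min (min a b + n) (j - 1)) := by
    induction n with
    | zero => exact ⟨filtration_anti (by lia) ha, filtration_anti (by lia) hb⟩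
    | succ n ih =>
      obtain h' | h' := le_or_gt (j - 1) (min a b + n)
      · exact ⟨filtration_anti (by lia) ih.1, filtration_anti (by lia) ih.2⟩
      · have hx' := hx_step (by lia) ih.1 ih.2
        have hy' := hy_step (by lia) hx' ih.2
        exact ⟨filtration_anti (by lia) hx', filtration_anti (by lia) hy'⟩
  obtain ⟨hx, hy⟩ := key (j - 1 - min a b).toNat
  have hx' : x ∈ v.filtration (j - 1) := filtration_anti (by lia) hx
  have hy' : y ∈ v.filtration (j - 1) := filtration_anti (by lia) hy
  exact ⟨by simpa using hx_step le_rfl hx' hy', hy'⟩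

/-- If `u` is a square modulo `4`, then `N(1 + ε)` has even valuation for every element
`ε = a + b √u` of norm `1` and integral trace. -/
theorem even_log_of_sq_mod_four {u c g a b : K} (hu : v u = 1) (hc : v c ≤ 1) (hg : v g ≤ 1)
    (h4 : (4 : K) ∈ v.filtration 0) (hucg : u = c ^ 2 + 4 * g) (hab : a ^ 2 - u * b ^ 2 = 1)
    (hinteg : v (2 + 2 * a) ≤ 1) (hne : 2 + 2 * a ≠ 0) : Even (log (v (2 + 2 * a))) := by
  set d := 2 + 2 * a with hd
  by_contra hodd
  rw [Int.not_even_iff_odd] at hodd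
  obtain ⟨k, hk⟩ : Odd (-log (v d)) := hodd.neg
  have hv0 : v d ≠ 0 := (v.ne_zero_iff).2 hne
  have hvd : v d = exp (-(2 * k + 1)) := by rw [← hk, neg_neg, exp_log hv0]
  have hk0 : 0 ≤ k := by
    rw [hvd, ← exp_zero, exp_le_exp] at hinteg
    lia
  have hdm := mem_filtration_of_eq hvd
  have hc' : c ∈ v.filtration 0 := by simpa [mem_filtration] using hc
  have hg' : g ∈ v.filtration 0 := by simpa [mem_filtration] using hg
  set X := 1 + a - b * c with hX
  set y := 2 * b with hy
  have hy' : y ∈ v.filtration (k + 1) := by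
    refine mem_filtration_of_sq_mem (l := 2 * k + 1) ?_ (by lia)
    refine mem_filtration_of_mul_mem (a := u) (m := 0) (l := 2 * k + 1) (by simpa using hu) ?_
      (by lia)
    have e : u * y ^ 2 = d * d - 4 * d := by rw [hy, hd]; linear_combination -4 * hab
    rw [e]
    exact sub_mem (mul_mem_filtration hdm hdm (by lia)) (mul_mem_filtration h4 hdm (by lia))
  have hdX : d = X ^ 2 + c * (X * y) - g * (y * y) := by
    rw [hX, hy, hd]; linear_combination -hab - b ^ 2 * hucg
  have hstep {i : ℤ} (hi : i ≤ k) (hXi : X ∈ v.filtration i) : X ∈ v.filtration (i + 1) := by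
    refine mem_filtration_of_sq_mem (l := 2 * i + 1) ?_ (by lia)
    have e : X ^ 2 = d - c * (X * y) + g * (y * y) := by rw [hdX]; ring
    rw [e]
    exact add_mem (sub_mem (filtration_anti (by lia) hdm)
      (mul_mem_filtration hc' (mul_mem_filtration hXi hy' le_rfl) (by lia)))
      (mul_mem_filtration hg' (mul_mem_filtration hy' hy' le_rfl) (by lia))
  obtain ⟨n₀, hn₀⟩ := exists_mem_filtration (v := v) X
  have key (n : ℕ) : X ∈ v.filtration (min (n₀ + n) (k + 1)) := by
    induction n with
    | zero => exact filtration_anti (by lia) hn₀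
    | succ n ih =>
      obtain h' | h' := le_or_gt (k + 1) (n₀ + n)
      · exact filtration_anti (by lia) ih
      · exact filtration_anti (by lia) (hstep (by lia) ih)
  have hX' : X ∈ v.filtration (k + 1) := filtration_anti (by lia) (key (k + 1 - n₀).toNat)
  have hfin : d ∈ v.filtration (2 * k + 2) := by
    rw [hdX, sq]
    exact sub_mem (add_mem (mul_mem_filtration hX' hX' (by lia))
      (mul_mem_filtration hc' (mul_mem_filtration hX' hy' le_rfl) (by lia)))
      (mul_mem_filtration hg' (mul_mem_filtration hy' hy' le_rfl) (by lia))
  rw [mem_filtration, hvd, exp_le_exp] at hfin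
  lia

end Valuation

namespace IsDedekindDomain.HeightOneSpectrum

open WithZero Valuation

variable {A K : Type*} [CommRing A] [IsDedekindDomain A] [Field K] [Algebra A K]
  [IsFractionRing A K] (p : HeightOneSpectrum A)

theorem algebraMap_mem_filtration_zero (a : A) :
    algebraMap A K a ∈ (p.valuation K).filtration 0 := by
  simpa [mem_filtration] using p.valuation_le_one a

theorem algebraMap_mem_filtration_one {a : A} :
    algebraMap A K a ∈ (p.valuation K).filtration 1 ↔ a ∈ p.asIdeal := by
  rw [mem_filtration, ← p.valuation_lt_one_iff_mem (K := K) a, ← exp_zero]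
  by_cases h : p.valuation K (algebraMap A K a) = 0
  · simp [h]
  · rw [← exp_log h, exp_le_exp, exp_lt_exp]
    lia

theorem exists_sub_mem_filtration_one {x : K} (hx : x ∈ (p.valuation K).filtration 0) :
    ∃ a : A, x - algebraMap A K a ∈ (p.valuation K).filtration 1 := by
  obtain ⟨a, ha⟩ := p.exists_valuation_sub_lt_of_integer (K := K) (x := x)
    (by simpa [mem_filtration] using hx) 1
  refine ⟨a, ?_⟩
  rw [← neg_mem_iff, neg_sub, mem_filtration]
  rw [Units.val_one, ← exp_zero] at ha
  by_cases h : p.valuation K (algebraMap A K a - x) = 0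
  · simp [h]
  · rw [← exp_log h, exp_lt_exp] at ha
    rw [← exp_log h, exp_le_exp]
    lia

theorem valuation_sub_sq_eq_odd [Finite (A ⧸ p.asIdeal)] {e : ℤ}
    (he : p.valuation K (2 : K) = exp (-e)) (he0 : 0 < e) {u : A}
    (hu : ∀ c : A, algebraMap A K (u - c ^ 2) ∉ (p.valuation K).filtration (2 * e)) :
    ∃ (c : A) (k : ℤ), p.valuation K (algebraMap A K (u - c ^ 2)) = exp (-(2 * k + 1)) ∧
      0 ≤ k ∧ k < e := by
  set v := p.valuation K
  have h2 : (2 : A) ∈ p.asIdeal := by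
    rw [← p.algebraMap_mem_filtration_one (K := K), mem_filtration, map_ofNat, he, exp_le_exp]
    lia
  have h2' : (2 : K) ∈ v.filtration e := mem_filtration_of_eq he
  let _ : Field (A ⧸ p.asIdeal) := Ideal.Quotient.field _
  have : CharP (A ⧸ p.asIdeal) 2 := by
    refine CharTwo.of_one_ne_zero_of_two_eq_zero one_ne_zero ?_
    rw [← map_ofNat (Ideal.Quotient.mk p.asIdeal) 2]
    exact Ideal.Quotient.eq_zero_iff_mem.2 h2
  obtain ⟨π, hπ⟩ := p.valuation_exists_uniformizer' (K := K)
  have hπ0 : algebraMap A K π ≠ 0 := ne_zero_of_eq_exp hπ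
  have hπn (n : ℕ) : v (algebraMap A K π ^ n) = exp (-(n : ℤ)) := by
    rw [map_pow, hπ, ← exp_nsmul]; simp
  have step (n : ℕ) (hn : ∀ k : ℕ, n ≠ 2 * k + 1) (c : A)
      (hc : algebraMap A K (u - c ^ 2) ∈ v.filtration n) (hne : (n : ℤ) < 2 * e) :
      ∃ c' : A, algebraMap A K (u - c' ^ 2) ∈ v.filtration (n + 1) := by
    obtain ⟨k, rfl⟩ : ∃ k, n = 2 * k := by
      obtain ⟨k, hk⟩ | ⟨k, hk⟩ := n.even_or_odd
      · exact ⟨k, by lia⟩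
      · exact absurd hk (hn k)
    set x := algebraMap A K (u - c ^ 2) / algebraMap A K π ^ (2 * k)
    have hx : algebraMap A K π ^ (2 * k) * x = algebraMap A K (u - c ^ 2) :=
      mul_div_cancel₀ _ (pow_ne_zero _ hπ0)
    have hx0 : x ∈ v.filtration 0 :=
      mem_filtration_of_mul_mem (hπn (2 * k)) (l := (2 * k : ℕ)) (by rwa [hx]) (by lia)
    obtain ⟨a, ha⟩ := p.exists_sub_mem_filtration_one hx0
    obtain ⟨r, hr⟩ := (FiniteField.isSquare_of_char_two (ringChar.eq (A ⧸ p.asIdeal) 2)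
      (Ideal.Quotient.mk p.asIdeal a))
    obtain ⟨r, rfl⟩ := Ideal.Quotient.mk_surjective r
    rw [← map_mul, Ideal.Quotient.eq, ← p.algebraMap_mem_filtration_one (K := K)] at hr
    refine ⟨c + π ^ k * r, ?_⟩
    have e' : algebraMap A K (u - (c + π ^ k * r) ^ 2) =
        algebraMap A K π ^ (2 * k) * ((x - algebraMap A K a) + algebraMap A K (a - r * r))
        - 2 * (algebraMap A K π ^ k * algebraMap A K (c * r)) := by
      rw [mul_add, mul_sub, hx]
      simp only [_root_.map_sub, _root_.map_add, map_mul, map_pow]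
      ring
    rw [e']
    exact sub_mem (mul_mem_filtration (mem_filtration_of_eq (hπn (2 * k))) (add_mem ha hr)
      (by lia)) (mul_mem_filtration h2' (mul_mem_filtration (mem_filtration_of_eq (hπn k))
        (p.algebraMap_mem_filtration_zero _) le_rfl) (by lia))
  by_contra! hcon
  have key (n : ℕ) (hn : (n : ℤ) ≤ 2 * e) :
      ∃ c : A, algebraMap A K (u - c ^ 2) ∈ v.filtration n := by
    induction n with
    | zero => exact ⟨0, p.algebraMap_mem_filtration_zero _⟩
    | succ n ih =>
      obtain ⟨c, hc⟩ := ih (by lia)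
      by_cases hodd : ∀ k : ℕ, n ≠ 2 * k + 1
      · simpa using step n hodd c hc (by lia)
      · push Not at hodd
        obtain ⟨k, rfl⟩ := hodd
        refine ⟨c, ?_⟩
        by_contra hnot
        have h0 : v (algebraMap A K (u - c ^ 2)) ≠ 0 := by
          intro h0
          exact hnot (by rw [mem_filtration, h0]; exact zero_le)
        have := hcon c k (by
          rw [mem_filtration, ← log_le_iff_le_exp h0] at hnot hc
          rw [← exp_log h0]
          congr 1
          lia) (by lia)
        push_cast at hn
        lia
  obtain ⟨c, hc⟩ := key (2 * e).toNat (by lia)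
  rw [Int.toNat_of_nonneg (by lia)] at hc
  exact hu c hc

/-- If `u` is not a square modulo `4` at a prime above `2`, some unit residue class is not
represented by the norm form `X² - u Y²`. -/
theorem exists_not_norm_mod_four [CharZero K] [Finite (A ⧸ p.asIdeal)]
    (h2 : (2 : A) ∈ p.asIdeal) {u : A} (hup : u ∉ p.asIdeal)
    (hu : ∀ c : A, ¬ p.valuation K (algebraMap A K (u - c ^ 2)) ≤ p.valuation K (4 : K)) :
    ∃ η : A, η ∉ p.asIdeal ∧ ∀ X Y : K,
      ¬ p.valuation K (X ^ 2 - algebraMap A K u * Y ^ 2 - algebraMap A K η) ≤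
        p.valuation K (4 : K) := by
  set v := p.valuation K
  obtain ⟨e, he⟩ : ∃ e : ℤ, v (2 : K) = exp (-e) :=
    ⟨-log (v 2), by rw [neg_neg, exp_log ((v.ne_zero_iff).2 two_ne_zero)]⟩
  have h4 : v (4 : K) = exp (-(2 * e)) := by
    rw [show (4 : K) = 2 * 2 by norm_num, map_mul, he, ← exp_add]
    congr 1
    ring
  have he0 : 0 < e := by
    rw [← p.algebraMap_mem_filtration_one (K := K), map_ofNat, mem_filtration] at h2
    change v 2 ≤ _ at h2
    rw [he, exp_le_exp] at h2
    lia
  rw [h4] at hu ⊢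
  obtain ⟨c, k, hck, hk0, hke⟩ := p.valuation_sub_sq_eq_odd he he0 hu
  change v _ = _ at hck
  lift k to ℕ using hk0
  have hc : v (algebraMap A K c) = 1 := by
    rw [p.valuation_eq_one_iff_notMem]
    intro hcp
    have : u - c ^ 2 ∈ p.asIdeal := by
      rw [← p.algebraMap_mem_filtration_one (K := K), mem_filtration]
      change v _ ≤ _
      rw [hck, exp_le_exp]
      lia
    exact hup (by simpa using add_mem this (Ideal.pow_mem_of_mem _ hcp 2 two_pos))
  obtain ⟨π, hπ⟩ := p.valuation_exists_uniformizer' (K := K)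
  set ϖ := algebraMap A K π
  have hπ0 : ϖ ≠ 0 := ne_zero_of_eq_exp hπ
  have hπn (n : ℕ) : v (ϖ ^ n) = exp (-(n : ℤ)) := by
    rw [map_pow, hπ, ← exp_nsmul]; simp
  obtain ⟨i, hi⟩ : ∃ i : ℕ, e = k + 1 + i := ⟨(e - k - 1).toNat, by lia⟩
  -- the Eisenstein relation of the uniformizer `(√u - c) / ϖ ^ k`
  set s := -2 * algebraMap A K c / ϖ ^ k with hs
  set q := algebraMap A K (u - c ^ 2) / ϖ ^ (2 * k) with hq
  have hvs : v s = exp (-((i : ℤ) + 1)) := by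
    rw [hs, map_div₀, map_mul, v.map_neg, he, hc, hπn, mul_one, ← exp_sub]
    congr 1
    lia
  have hvq : v q = exp (-1) := by
    rw [hq, map_div₀, hck, hπn, ← exp_sub]
    congr 1
    push_cast
    lia
  have hq0 : q ≠ 0 := ne_zero_of_eq_exp hvq
  have hsm := mem_filtration_of_eq hvs
  have hqm := mem_filtration_of_eq hvq
  have h2m : (2 : K) ∈ v.filtration (i + 1) := filtration_anti (by lia) (mem_filtration_of_eq he)
  have hexists : ∃ r : A, ∀ y ∈ v.filtration i,
      s * y - q * y ^ 2 - ϖ ^ (2 * i + 1) * algebraMap A K r ∉ v.filtration (2 * i + 2) := by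
    by_contra! hall
    have happ (r : A) : ∃ (y : K) (a : A), y ∈ v.filtration i ∧
        s * y - q * y ^ 2 - ϖ ^ (2 * i + 1) * algebraMap A K r ∈ v.filtration (2 * i + 2) ∧
        y - ϖ ^ i * algebraMap A K a ∈ v.filtration (i + 1) := by
      obtain ⟨y, hy, hyr⟩ := hall r
      have hy0 : y / ϖ ^ i ∈ v.filtration 0 :=
        mem_filtration_of_mul_mem (hπn i) (l := i)
          (by rwa [mul_div_cancel₀ _ (pow_ne_zero _ hπ0)]) (by lia)
      obtain ⟨a, ha⟩ := p.exists_sub_mem_filtration_one hy0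
      refine ⟨y, a, hy, hyr, ?_⟩
      have := mul_mem_filtration (mem_filtration_of_eq (hπn i)) ha le_rfl
      rwa [mul_sub, mul_div_cancel₀ _ (pow_ne_zero _ hπ0)] at this
    choose y a hy hyr ha using happ
    -- the value of the form determines the class of `r`
    have hform {x x' : K} (hx : x ∈ v.filtration i) (hx' : x' ∈ v.filtration i)
        (h : x - x' ∈ v.filtration (i + 1)) :
        (s * x - q * x ^ 2) - (s * x' - q * x' ^ 2) ∈ v.filtration (2 * i + 2) := by
      have e' : (s * x - q * x ^ 2) - (s * x' - q * x' ^ 2) =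
          s * (x - x') - q * ((x + x') * (x - x')) := by ring
      rw [e']
      exact sub_mem (mul_mem_filtration hsm h (by lia)) (mul_mem_filtration hqm
        (mul_mem_filtration (add_mem hx hx') h le_rfl) (by lia))
    have hclass {r r' : A} (h : algebraMap A K (a r - a r') ∈ v.filtration 1) :
        r - r' ∈ p.asIdeal := by
      rw [← p.algebraMap_mem_filtration_one (K := K)]
      refine mem_filtration_of_mul_mem (hπn (2 * i + 1)) (l := 2 * i + 2) ?_ (by push_cast; lia)
      have hyy : y r - y r' ∈ v.filtration (i + 1) := by
        have e' : y r - y r' = (y r - ϖ ^ i * algebraMap A K (a r))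
            - (y r' - ϖ ^ i * algebraMap A K (a r')) + ϖ ^ i * algebraMap A K (a r - a r') := by
          rw [_root_.map_sub]; ring
        rw [e']
        exact add_mem (sub_mem (ha r) (ha r'))
          (mul_mem_filtration (mem_filtration_of_eq (hπn i)) h le_rfl)
      have e' : ϖ ^ (2 * i + 1) * algebraMap A K (r - r') =
          ((s * y r - q * y r ^ 2) - (s * y r' - q * y r' ^ 2))
          - (s * y r - q * y r ^ 2 - ϖ ^ (2 * i + 1) * algebraMap A K r)
          + (s * y r' - q * y r' ^ 2 - ϖ ^ (2 * i + 1) * algebraMap A K r') := by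
        rw [_root_.map_sub]; ring
      rw [e']
      exact add_mem (sub_mem (hform (hy r) (hy r') hyy) (hyr r)) (hyr r')
    let f : A ⧸ p.asIdeal → A ⧸ p.asIdeal := fun t ↦ Ideal.Quotient.mk _ (a (Quotient.out t))
    have hf : Function.Injective f := by
      intro t t' htt
      rw [Ideal.Quotient.eq, ← p.algebraMap_mem_filtration_one (K := K)] at htt
      have := Ideal.Quotient.eq.2 (hclass htt)
      simpa using this
    have hsurj := Finite.surjective_of_injective hf
    -- a root `z` of the form yields the zero class
    have hroot {z : K} (hz : z ∈ v.filtration i) (hz0 : s * z - q * z ^ 2 = 0) :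
        ∃ r ∈ p.asIdeal, z - ϖ ^ i * algebraMap A K (a r) ∈ v.filtration (i + 1) ∧
          r = Quotient.out (Ideal.Quotient.mk p.asIdeal r) := by
      have hz1 : z / ϖ ^ i ∈ v.filtration 0 :=
        mem_filtration_of_mul_mem (hπn i) (l := i)
          (by rwa [mul_div_cancel₀ _ (pow_ne_zero _ hπ0)]) (by lia)
      obtain ⟨b, hb⟩ := p.exists_sub_mem_filtration_one hz1
      obtain ⟨t, ht⟩ := hsurj (Ideal.Quotient.mk _ b)
      rw [Ideal.Quotient.eq, ← p.algebraMap_mem_filtration_one (K := K)] at ht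
      have hza : z - ϖ ^ i * algebraMap A K (a t.out) ∈ v.filtration (i + 1) := by
        have := mul_mem_filtration (mem_filtration_of_eq (hπn i)) (sub_mem hb ht) le_rfl
        convert this using 1
        rw [_root_.map_sub]
        field_simp
        ring
      refine ⟨t.out, ?_, hza, by simp⟩
      rw [← p.algebraMap_mem_filtration_one (K := K)]
      refine mem_filtration_of_mul_mem (hπn (2 * i + 1)) (l := 2 * i + 2) ?_ (by push_cast; lia)
      have hyz : y t.out - z ∈ v.filtration (i + 1) := by
        simpa using sub_mem (ha t.out) hza
      have := sub_mem (hform (hy t.out) hz hyz) (hyr t.out)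
      rwa [hz0, sub_zero, sub_sub_cancel] at this
    obtain ⟨r, hr, hr', hr''⟩ := hroot (z := 0) (zero_mem _) (by simp)
    have hsq : v (s / q) = exp (-(i : ℤ)) := by
      rw [map_div₀, hvs, hvq, ← exp_sub]
      congr 1
      lia
    obtain ⟨r₁, hr₁, hr₁', hr₁''⟩ := hroot (z := s / q) (mem_filtration_of_eq hsq)
      (by field_simp; ring)
    have hrr : r = r₁ := by
      rw [hr'', hr₁'', Ideal.Quotient.eq_zero_iff_mem.2 hr, Ideal.Quotient.eq_zero_iff_mem.2 hr₁]
    subst hrr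
    have := sub_mem hr₁' hr'
    rw [sub_sub_sub_cancel_right, sub_zero, mem_filtration, hsq, exp_le_exp] at this
    lia
  obtain ⟨r, hr⟩ := hexists
  have hπp : π ∈ p.asIdeal := by
    rw [← p.algebraMap_mem_filtration_one (K := K)]
    exact mem_filtration_of_eq hπ
  refine ⟨1 + π ^ (2 * i + 1) * r, ?_, fun X Y hXY ↦ ?_⟩
  · intro h
    have : π ^ (2 * i + 1) * r ∈ p.asIdeal :=
      Ideal.mul_mem_right _ _ (Ideal.pow_mem_of_mem _ hπp _ (by lia))
    exact p.isPrime.ne_top ((Ideal.eq_top_iff_one _).2 (by simpa using sub_mem h this))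
  · change _ ∈ v.filtration (2 * e) at hXY
    set x := X + algebraMap A K c * Y - 1
    set y := ϖ ^ k * Y
    have hsy : s * y = -2 * algebraMap A K c * Y := by
      simp only [hs, y]; field_simp
    have hqy : q * y ^ 2 = algebraMap A K (u - c ^ 2) * Y ^ 2 := by
      simp only [hq, y, mul_pow, ← pow_mul, mul_comm k 2]; field_simp
    have e' : X ^ 2 - algebraMap A K u * Y ^ 2 - algebraMap A K (1 + π ^ (2 * i + 1) * r) =
        (x ^ 2 + 2 * x + s * y + s * (x * y) - q * y ^ 2) - ϖ ^ (2 * i + 1) * algebraMap A K r := by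
      rw [show s * (x * y) = x * (s * y) by ring, hsy, hqy]
      simp only [_root_.map_sub, _root_.map_add, map_mul, map_pow, map_one, x, ϖ]
      ring
    rw [e'] at hXY
    have hXY' := filtration_anti (k := 2 * i + 2) (by lia) hXY
    have hr1 : ϖ ^ (2 * i + 1) * algebraMap A K r ∈ v.filtration (2 * i + 1) :=
      mul_mem_filtration (mem_filtration_of_eq (hπn _)) (p.algebraMap_mem_filtration_zero r)
        (by push_cast; lia)
    obtain ⟨hx, hy⟩ := mem_filtration_of_ramified_norm (j := i + 1) hvq hsm h2m
      (filtration_anti (l := 2 * i + 1) (by lia)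
        (by simpa using add_mem (filtration_anti (by lia) hXY') hr1)) (by lia)
    rw [add_sub_cancel_right] at hy
    refine hr y hy ?_
    have e'' : s * y - q * y ^ 2 - ϖ ^ (2 * i + 1) * algebraMap A K r =
        ((x ^ 2 + 2 * x + s * y + s * (x * y) - q * y ^ 2) - ϖ ^ (2 * i + 1) * algebraMap A K r)
        - x * x - 2 * x - s * (x * y) := by ring
    rw [e'']
    exact sub_mem (sub_mem (sub_mem hXY' (mul_mem_filtration hx hx (by lia)))
      (mul_mem_filtration h2m hx (by lia)))
      (mul_mem_filtration hsm (mul_mem_filtration hx hy le_rfl) (by lia))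

end IsDedekindDomain.HeightOneSpectrum

namespace AddCommGroup

theorem index_range_nsmul_two_int_pi (ι : Type*) [Fintype ι] :
    (nsmulAddMonoidHom (α := ι → ℤ) 2).range.index = 2 ^ Fintype.card ι := by
  let f : (ι → ℤ) →+ (ι → ZMod 2) := (Int.castAddHom (ZMod 2)).compLeft ι
  have hf : Function.Surjective f := fun x => by
    choose y hy using fun i => ZMod.intCast_surjective (x i)
    exact ⟨y, funext hy⟩
  have : (nsmulAddMonoidHom (α := ι → ℤ) 2).range = f.ker := by
    ext x
    simp only [AddMonoidHom.mem_range, AddMonoidHom.mem_ker, nsmulAddMonoidHom_apply, funext_iff]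
    have : ∀ i, f x i = 0 ↔ ∃ y, 2 * y = x i := fun i => by
      change ((x i : ℤ) : ZMod 2) = 0 ↔ _
      rw [ZMod.intCast_zmod_eq_zero_iff_dvd]
      exact ⟨fun ⟨y, h⟩ => ⟨y, h.symm⟩, fun ⟨y, h⟩ => ⟨y, h.symm⟩⟩
    simp only [Pi.zero_apply, this, Pi.smul_apply, nsmul_eq_mul, Nat.cast_ofNat]
    exact ⟨fun ⟨y, h⟩ i => ⟨y i, h i⟩, fun h => ⟨fun i => (h i).choose, fun i => (h i).choose_spec⟩⟩
  rw [this, AddSubgroup.index_ker, AddMonoidHom.range_eq_top.mpr hf]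
  simp [Nat.card_fun]

theorem index_range_nsmul_two_of_equiv {G D : Type*} [AddCommGroup G] [AddCommGroup D] [Finite D]
    {n : ℕ} (e : G ≃+ (Fin n → ℤ) × D) :
    (nsmulAddMonoidHom (α := G) 2).range.index =
      2 ^ Module.finrank ℤ G * Nat.card (nsmulAddMonoidHom (α := G) 2).ker := by
  have : Module.Finite ℤ G := Module.Finite.equiv e.symm.toIntLinearEquiv
  have hrank : Module.finrank ℤ G = n := by
    let f : G →ₗ[ℤ] (Fin n → ℤ) := LinearMap.fst ℤ _ D ∘ₗ e.toIntLinearEquiv.toLinearMap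
    have hf : Function.Surjective f := fun x => ⟨e.symm (x, 0), by simp [f]⟩
    have hker : Module.finrank ℤ (LinearMap.ker f) = 0 := by
      rw [Module.finrank_eq_zero_iff_isTorsion]
      rintro ⟨x, hx⟩
      refine ⟨⟨Nat.card D, mem_nonZeroDivisors_of_ne_zero (by exact_mod_cast Nat.card_pos.ne')⟩, ?_⟩
      ext
      rw [← e.injective.eq_iff]
      have hx : (e x).1 = 0 := hx
      simp [Submonoid.smul_def, Prod.ext_iff, hx]
    have := (LinearMap.ker f).finrank_quotient_add_finrank
    rw [(f.quotKerEquivOfSurjective hf).finrank_eq, hker] at this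
    simpa using this.symm
  have hrange : (nsmulAddMonoidHom (α := G) 2).range.map (e : G →+ (Fin n → ℤ) × D) =
      (nsmulAddMonoidHom (α := Fin n → ℤ) 2).range.prod (nsmulAddMonoidHom (α := D) 2).range := by
    ext ⟨x, y⟩
    simp only [AddSubgroup.mem_map, AddMonoidHom.mem_range, nsmulAddMonoidHom_apply,
      AddSubgroup.mem_prod]
    constructor
    · rintro ⟨_, ⟨g, rfl⟩, h⟩
      rw [AddMonoidHom.coe_coe, map_nsmul, Prod.ext_iff] at h
      exact ⟨⟨_, h.1⟩, ⟨_, h.2⟩⟩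
    · rintro ⟨⟨x, rfl⟩, ⟨y, rfl⟩⟩
      exact ⟨_, ⟨e.symm (x, y), rfl⟩, by simp⟩
  have hker : Nat.card (nsmulAddMonoidHom (α := G) 2).ker =
      Nat.card (nsmulAddMonoidHom (α := D) 2).ker := by
    have (g : G) : 2 • g = 0 ↔ (e g).1 = 0 ∧ 2 • (e g).2 = 0 := by
      rw [← e.map_eq_zero_iff, map_nsmul, Prod.ext_iff]
      simp only [Prod.fst_zero, Prod.snd_zero, Prod.smul_fst, Prod.smul_snd]
      rw [smul_eq_zero_iff_right two_ne_zero]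
    refine Nat.card_congr ⟨fun g => ⟨(e g).2, ((this g).1 g.2).2⟩,
      fun d => ⟨e.symm (0, d), (this _).2 (by simpa using show 2 • d.1 = 0 from d.2)⟩,
      fun g => ?_, fun d => ?_⟩
    · ext
      rw [← e.injective.eq_iff]
      simp [Prod.ext_iff, ((this g).1 g.2).1]
    · simp
  rw [← AddSubgroup.index_map_equiv _ e, hrange, AddSubgroup.index_prod,
    index_range_nsmul_two_int_pi, AddSubgroup.index_range, hrank, hker, Fintype.card_fin]

/-- In a finitely generated abelian group of rank `r`, the index of the subgroup of doubles is
`2 ^ r` times the order of the `2`-torsion subgroup. -/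
theorem index_range_nsmul_two (G : Type*) [AddCommGroup G] [AddGroup.FG G] :
    (nsmulAddMonoidHom (α := G) 2).range.index =
      2 ^ Module.finrank ℤ G * Nat.card (nsmulAddMonoidHom (α := G) 2).ker := by
  obtain ⟨n, ι, _, q, hq, k, ⟨e⟩⟩ := AddCommGroup.equiv_free_prod_directSum_zmod G
  have (i : ι) : NeZero (q i ^ k i) := ⟨pow_ne_zero _ (hq i).ne_zero⟩
  classical
  have hfin : Finite (DirectSum ι fun i => ZMod (q i ^ k i)) :=
    Finite.of_equiv _ (DirectSum.addEquivProd fun i => ZMod (q i ^ k i)).symm.toEquiv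
  exact index_range_nsmul_two_of_equiv (e.trans
    ((Finsupp.linearEquivFunOnFinite ℤ ℤ (Fin n)).toAddEquiv.prodCongr (AddEquiv.refl _)))

end AddCommGroup

namespace CommGroup

theorem finite_additive_ker {G H : Type*} [CommGroup G] [CommGroup H]
    [Module.Finite ℤ (Additive G)] (f : G →* H) : Module.Finite ℤ (Additive f.ker) :=
  inferInstanceAs (Module.Finite ℤ (LinearMap.ker f.toAdditive.toIntLinearMap))

theorem finrank_le_finrank_add_finrank_ker {G H : Type*} [CommGroup G] [CommGroup H]
    [Module.Finite ℤ (Additive G)] [Module.Finite ℤ (Additive H)] (f : G →* H) :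
    Module.finrank ℤ (Additive G) ≤
      Module.finrank ℤ (Additive H) + Module.finrank ℤ (Additive f.ker) := by
  let F : Additive G →ₗ[ℤ] Additive H := f.toAdditive.toIntLinearMap
  have := (LinearMap.ker F).finrank_quotient_add_finrank
  rw [F.quotKerEquivRange.finrank_eq] at this
  rw [← this]
  have h := (LinearMap.range F).finrank_le
  exact Nat.add_le_add_right h _

/-- In a finitely generated abelian group of rank `r`, the index of the subgroup of squares is
`2 ^ r` times the order of the `2`-torsion subgroup. -/
theorem index_range_pow_two (G : Type*) [CommGroup G] [Module.Finite ℤ (Additive G)] :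
    (powMonoidHom (α := G) 2).range.index =
      2 ^ Module.finrank ℤ (Additive G) * Nat.card (powMonoidHom (α := G) 2).ker :=
  have : AddGroup.FG (Additive G) := Module.Finite.iff_addGroup_fg.1 inferInstance
  AddCommGroup.index_range_nsmul_two (Additive G)

end CommGroup

namespace Subgroup

variable {G H : Type*} [CommGroup G] [CommGroup H]

/-- The index of the squares of the kernel of `N : G → H`, when `N` admits a map `ι` with
`N (ι z) = z ^ 2`. -/
theorem index_sq_ker_mul_index_range_le (N : G →* H) (ι : H →* G) (hι : ∀ z, N (ι z) = z ^ 2)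
    (ψ : G →* G) (hψ : ∀ g, ψ g = g ^ 2 / ι (N g))
    (h0 : (powMonoidHom (α := H) 2).range.index ≠ 0) :
    (powMonoidHom (α := N.ker) 2).range.index * N.range.index ≤
      (powMonoidHom (α := H) 2).range.index * ψ.range.relIndex N.ker := by
  have hsq : N.ker.map (powMonoidHom 2) ≤ ψ.range := by
    rintro _ ⟨g, hg, rfl⟩
    exact ⟨g, by simp [hψ, N.mem_ker.1 hg]⟩
  have hψN : ψ.range ≤ N.ker := by
    rintro _ ⟨g, rfl⟩
    simp [hψ, hι, MonoidHom.mem_ker]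
  have hle : (powMonoidHom (α := H) 2).range ≤ N.range := by
    rintro _ ⟨z, rfl⟩
    exact ⟨ι z, by simp [hι]⟩
  have h1 : (powMonoidHom (α := N.ker) 2).range.index =
      (N.ker.map (powMonoidHom 2)).relIndex N.ker := by
    rw [relIndex]
    congr 1
    ext ⟨x, hx⟩
    simp [mem_subgroupOf, Subtype.ext_iff]
  have h2 : (N.ker.map (powMonoidHom 2)).relIndex ψ.range ∣
      (powMonoidHom (α := H) 2).range.relIndex N.range := by
    rw [← index_comap, ← index_comap]
    refine index_dvd_of_le ?_
    rintro g ⟨z, hz⟩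
    refine ⟨g / ι z, ?_, ?_⟩
    · simp [MonoidHom.mem_ker, hι, ← hz]
    · simp [hψ, ← hz, div_pow]
  have h3 : (powMonoidHom (α := H) 2).range.relIndex N.range ≠ 0 := fun h =>
    h0 (by rw [← relIndex_mul_index hle, h, zero_mul])
  rw [h1, ← relIndex_mul_relIndex _ _ _ hsq hψN, ← relIndex_mul_index hle]
  calc _ ≤ (powMonoidHom (α := H) 2).range.relIndex N.range * ψ.range.relIndex N.ker
        * N.range.index := by
        gcongr
        exact Nat.le_of_dvd (Nat.pos_of_ne_zero h3) h2
    _ = _ := by ring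

end Subgroup

namespace IsDedekindDomain.HeightOneSpectrum

open WithZero

variable {A : Type*} [CommRing A] [IsDedekindDomain A]

theorem exists_eq_units_mul_sq_of_even_log_intValuation [IsPrincipalIdealRing A] {c : A}
    (hc : c ≠ 0) (h : ∀ p : HeightOneSpectrum A, Even (log (p.intValuation c))) :
    ∃ (η : Aˣ) (d : A), c = η * d ^ 2 := by
  obtain ⟨b, hb⟩ : ∃ b, Associates.mk (Ideal.span {c}) = b ^ 2 := by
    refine Associates.is_pow_of_dvd_count (by simpa using hc) fun q hq => ?_
    obtain ⟨q, rfl⟩ := Associates.mk_surjective q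
    have hq := Associates.irreducible_mk.1 hq
    let p : HeightOneSpectrum A := ⟨q, (Ideal.isPrime_of_prime hq.prime), hq.ne_zero⟩
    have := h p
    rw [p.intValuation_if_neg hc, log_exp, even_neg, even_iff_two_dvd] at this
    exact_mod_cast this
  obtain ⟨I, rfl⟩ := Associates.mk_surjective b
  obtain ⟨d, rfl⟩ := (IsPrincipalIdealRing.principal I).principal
  rw [← Associates.mk_pow, Associates.mk_eq_mk_iff_associated, associated_iff_eq,
    Ideal.submodule_span_eq, Ideal.span_singleton_pow, Ideal.span_singleton_eq_span_singleton] at hb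
  obtain ⟨η, hη⟩ := hb.symm
  exact ⟨η, d, by rw [← hη, mul_comm]⟩

/-- Over a principal ideal domain, an element of the fraction field all of whose valuations are
even is a unit times a square. -/
theorem exists_eq_units_mul_sq_of_even_log_valuation [IsPrincipalIdealRing A] {K : Type*} [Field K]
    [Algebra A K] [IsFractionRing A K] {z : K} (hz : z ≠ 0)
    (h : ∀ p : HeightOneSpectrum A, Even (log (p.valuation K z))) :
    ∃ (η : Aˣ) (w : K), w ≠ 0 ∧ z = algebraMap A K η * w ^ 2 := by
  obtain ⟨a, b, hb, rfl⟩ := IsFractionRing.div_surjective (A := A) z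
  have hb0 : algebraMap A K b ≠ 0 := IsFractionRing.to_map_ne_zero_of_mem_nonZeroDivisors hb
  have ha0 : algebraMap A K a ≠ 0 := fun h => hz (by simp [h])
  have hab : a * b ≠ 0 := fun h => mul_ne_zero ha0 hb0 (by rw [← map_mul, h, map_zero])
  obtain ⟨η, d, hd⟩ := exists_eq_units_mul_sq_of_even_log_intValuation hab fun p => by
    have hp := h p
    rw [← p.valuation_of_algebraMap (K := K)]
    change Even (log (p.valuation K (algebraMap A K (a * b))))
    rw [map_mul, map_mul, log_mul (by simpa using ha0)
      (by simpa using hb0)]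
    rw [map_div₀, log_div (by simpa using ha0) (by simpa using hb0), Int.even_sub] at hp
    rwa [Int.even_add]
  have hd' := congrArg (algebraMap A K) hd
  simp only [map_mul, map_pow] at hd'
  refine ⟨η, algebraMap A K d / algebraMap A K b, div_ne_zero (fun h => ?_) hb0, ?_⟩
  · exact mul_ne_zero ha0 hb0 (by rw [hd', h]; simp)
  · field_simp
    exact hd'

theorem finite_setOf_mem {a : A} (ha : a ≠ 0) :
    {p : HeightOneSpectrum A | a ∈ p.asIdeal}.Finite := by
  simpa [Ideal.dvd_span_singleton] using
    Ideal.finite_factors (I := Ideal.span {a}) (by simpa using ha)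

/-- If units of `A` realise all classes of units modulo `m`, then they realise all prescribed
residues modulo `m` at finitely many primes containing `m`. -/
theorem exists_units_sub_valuation_le {m : A} (hm : m ≠ 0)
    (hsurj : Function.Surjective (Units.map (Ideal.Quotient.mk (Ideal.span {m})).toMonoidHom))
    (K : Type*) [Field K] [Algebra A K] [IsFractionRing A K] (η : HeightOneSpectrum A → A)
    (hη : ∀ p : HeightOneSpectrum A, m ∈ p.asIdeal → η p ∉ p.asIdeal) :
    ∃ ε : Aˣ, ∀ p : HeightOneSpectrum A, m ∈ p.asIdeal →
      p.valuation K (algebraMap A K (ε - η p)) ≤ p.valuation K (algebraMap A K m) := by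
  have hex (p : HeightOneSpectrum A) : ∃ e : ℕ, exp (-(e : ℤ)) = p.intValuation m :=
    ⟨_, (p.intValuation_if_neg hm).symm⟩
  choose e he using hex
  let s := (finite_setOf_mem hm).toFinset
  have hs (p : HeightOneSpectrum A) : p ∈ s ↔ m ∈ p.asIdeal := by simp [s]
  obtain ⟨x, hx⟩ := IsDedekindDomain.exists_forall_sub_mem_ideal (s := s)
    (fun p => p.asIdeal) e (fun p _ => p.prime)
    (fun p _ q _ hpq h => hpq (HeightOneSpectrum.ext h)) (fun p => η p)
  have hxp (p : HeightOneSpectrum A) (hp : m ∈ p.asIdeal) : x ∉ p.asIdeal := fun h => by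
    have he0 : e p ≠ 0 := fun h0 => by
      have := he p
      rw [h0, Nat.cast_zero, neg_zero, exp_zero, eq_comm, intValuation_eq_one_iff] at this
      exact this hp
    exact hη p hp ((Submodule.sub_mem_iff_right _ h).1 (Ideal.pow_le_self he0 (hx p ((hs p).2 hp))))
  have hux : IsUnit (Ideal.Quotient.mk (Ideal.span {m}) x) := by
    by_contra hux
    obtain ⟨M, hM, hxM⟩ := exists_max_ideal_of_mem_nonunits hux
    let P := M.comap (Ideal.Quotient.mk (Ideal.span {m}))
    have hPm : m ∈ P := by
      have : Ideal.Quotient.mk (Ideal.span {m}) m = 0 :=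
        Ideal.Quotient.eq_zero_iff_mem.2 (Ideal.mem_span_singleton_self m)
      simp [P, Ideal.mem_comap, this]
    have hP : P.IsPrime := Ideal.comap_isPrime _ _
    exact hxp ⟨P, hP, fun h => hm (by simpa [h] using hPm)⟩ hPm hxM
  obtain ⟨ε, hε⟩ := hsurj hux.unit
  refine ⟨ε, fun p hp => ?_⟩
  have h1 : (ε : A) - x ∈ Ideal.span {m} := by
    rw [← Ideal.Quotient.eq]
    simpa [Units.ext_iff] using hε
  rw [Ideal.mem_span_singleton] at h1
  obtain ⟨r, hr⟩ := h1
  have h2 := hx p ((hs p).2 hp)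
  rw [← intValuation_le_pow_iff_mem, he] at h2
  rw [valuation_of_algebraMap, valuation_of_algebraMap, ← sub_add_sub_cancel _ x, hr]
  refine (Valuation.map_add _ _ _).trans (max_le ?_ h2)
  rw [map_mul]
  exact mul_le_of_le_one_right' (p.intValuation_le_one r)

/-- A subgroup of units avoiding a residue class modulo `m` at each prime of `T` has index at
least `2 ^ #T`, if units realise all classes modulo `m`. -/
theorem two_pow_card_le_index {m : A} (hm : m ≠ 0)
    (hsurj : Function.Surjective (Units.map (Ideal.Quotient.mk (Ideal.span {m})).toMonoidHom))
    (K : Type*) [Field K] [Algebra A K] [IsFractionRing A K] (T : Finset (HeightOneSpectrum A))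
    (R : Subgroup Aˣ) (hR : R.index ≠ 0) (hT : ∀ p ∈ T, m ∈ p.asIdeal ∧ ∃ η : A, η ∉ p.asIdeal ∧
      ∀ ε ∈ R, ¬ p.valuation K (algebraMap A K (ε - η)) ≤ p.valuation K (algebraMap A K m)) :
    2 ^ T.card ≤ R.index := by
  classical
  choose! hmT η hηp hη using hT
  have hex (S : Finset T) := exists_units_sub_valuation_le hm hsurj K
    (fun p => if h : p ∈ T then (if ⟨p, h⟩ ∈ S then η p else 1) else 1) (fun p hp => by
      split_ifs with h h'
      · exact hηp p h
      all_goals exact (Ideal.ne_top_iff_one _).1 p.isPrime.ne_top)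
  choose ε hε using hex
  have key (S S' : Finset T) (h : (ε S / ε S' : Aˣ) ∈ R) : S ⊆ S' := by
    intro p hp
    by_contra hp'
    have h1 := hε S p (hmT p p.2)
    have h2 := hε S' p (hmT p p.2)
    simp only [SetLike.coe_mem, ↓reduceDIte, hp, hp', if_true, if_false, Subtype.coe_eta] at h1 h2
    refine hη p p.2 _ h ?_
    have : ((ε S / ε S' : Aˣ) : A) - η p =
        ((ε S')⁻¹ : Aˣ) * ((ε S - η p) - η p * (ε S' - 1)) := by
      rw [div_eq_inv_mul, Units.val_mul]
      linear_combination η p * (ε S').inv_mul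
    rw [this, map_mul, map_mul]
    refine (mul_le_of_le_one_left' (p.1.valuation_le_one _)).trans ?_
    rw [map_sub]
    refine (Valuation.map_sub _ _ _).trans (max_le h1 ?_)
    rw [map_mul, map_mul]
    exact (mul_le_of_le_one_left' (p.1.valuation_le_one _)).trans h2
  have hinj : Function.Injective fun S : Finset T => (QuotientGroup.mk (ε S) : Aˣ ⧸ R) := by
    intro S S' h
    have h := QuotientGroup.eq.1 h
    refine (key S S' ?_).antisymm (key S' S ?_)
    · simpa [div_eq_mul_inv, mul_comm] using R.inv_mem h
    · simpa [div_eq_mul_inv, mul_comm] using h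
  have : Finite (Aˣ ⧸ R) := Nat.finite_of_card_ne_zero hR
  simpa [Subgroup.index] using Nat.card_le_card_of_injective _ hinj

end IsDedekindDomain.HeightOneSpectrum

namespace QuadraticAlgebra

variable {K : Type*} [Field K] {u : K}

theorem algebra_norm_eq_norm (z : QuadraticAlgebra K u 0) : Algebra.norm K z = z.norm := by
  rw [← det_toLinearMap_eq_norm, Algebra.norm_apply]
  rfl

theorem norm_eq_sub (z : QuadraticAlgebra K u 0) : z.norm = z.re ^ 2 - u * z.im ^ 2 := by
  rw [norm_def]
  ring

theorem norm_one_add {ε : QuadraticAlgebra K u 0} (hε : ε.norm = 1) :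
    (1 + ε).norm = 2 + 2 * ε.re := by
  rw [norm_eq_sub] at hε ⊢
  simp only [re_add, im_add, re_one, im_one]
  linear_combination hε

theorem finrank_rat [NumberField K] :
    Module.finrank ℚ (QuadraticAlgebra K u 0) = 2 * Module.finrank ℚ K := by
  rw [← Module.finrank_mul_finrank ℚ K, finrank_eq_two, mul_comm]

variable [Fact (∀ r : K, r ^ 2 ≠ u + 0 * r)]

/-- The relation `α ^ 2 = ε * norm α` of Hilbert's theorem 90. -/
theorem exists_sq_eq_mul_norm {ε : QuadraticAlgebra K u 0} (hε : ε.norm = 1) :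
    ∃ α : QuadraticAlgebra K u 0, α ≠ 0 ∧ α ^ 2 = ε * algebraMap K _ α.norm := by
  by_cases h : 1 + ε = 0
  · refine ⟨ω, fun h0 => ?_, ?_⟩
    · simpa using congrArg im h0
    · obtain rfl : ε = -1 := (neg_eq_of_add_eq_zero_right h).symm
      ext <;> simp [pow_two, norm_eq_sub, algebraMap_eq]
  · refine ⟨1 + ε, h, ?_⟩
    rw [algebraMap_norm_eq_mul_star]
    have : ε * star ε = 1 := by rw [← algebraMap_norm_eq_mul_star, hε, map_one]
    rw [star_add, star_one]
    linear_combination (-(1 + ε)) * this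

theorem norm_ne_zero {z : QuadraticAlgebra K u 0} (hz : z ≠ 0) : z.norm ≠ 0 :=
  fun h => hz (norm_eq_zero_iff_eq_zero.1 h)

theorem norm_one_add_mul_norm {α ε : QuadraticAlgebra K u 0} (hα0 : α ≠ 0)
    (hα : α ^ 2 = ε * algebraMap K _ α.norm) :
    (1 + ε).norm * α.norm = (2 * α.re) ^ 2 := by
  rw [algebraMap_norm_eq_mul_star] at hα
  have h1 : α = ε * star α := mul_left_cancel₀ hα0 (by linear_combination hα)
  have h2 : (1 + ε) * star α = algebraMap K _ (2 * α.re) := by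
    rw [add_mul, one_mul, ← h1]
    ext <;> simp [algebraMap_eq, two_mul]
  rw [← norm_star α, ← map_mul, h2, norm_algebraMap]

theorem norm_eq_one_of_sq_eq {α ε : QuadraticAlgebra K u 0} (hα0 : α ≠ 0)
    (hα : α ^ 2 = ε * algebraMap K _ α.norm) : ε.norm = 1 := by
  have := congrArg norm hα
  rw [map_pow, map_mul, norm_algebraMap] at this
  exact mul_right_cancel₀ (pow_ne_zero 2 (norm_ne_zero hα0)) (this.symm.trans (one_mul _).symm)

variable [NumberField K]

instance : NumberField (QuadraticAlgebra K u 0) where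
  to_charZero := inferInstance
  to_finiteDimensional := Module.Finite.trans (R := ℚ) K _

theorem isTotallyReal [IsTotallyReal K] (hu : ∀ σ : K →+* ℝ, 0 < σ u) :
    IsTotallyReal (QuadraticAlgebra K u 0) where
  isReal v := by
    rw [InfinitePlace.isReal_iff, ComplexEmbedding.isReal_iff]
    set φ := v.embedding
    have hφ : ComplexEmbedding.IsReal (φ.comp (algebraMap K _)) :=
      IsTotallyReal.complexEmbedding_isReal _
    have hφx (x : K) : φ (algebraMap K _ x) = hφ.embedding x := by
      rw [hφ.coe_embedding_apply]
      rfl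
    have hω : (φ ω) ^ 2 = (hφ.embedding u : ℂ) := by
      rw [← hφx, ← map_pow]
      congr 1
      ext <;> simp [pow_two, algebraMap_eq]
    have hω' : (φ ω).im = 0 := by
      have h0 := hu hφ.embedding
      have hre := congrArg Complex.re hω
      have him := congrArg Complex.im hω
      simp only [pow_two, Complex.mul_re, Complex.mul_im, Complex.ofReal_re,
        Complex.ofReal_im] at hre him
      by_contra hne
      have : (φ ω).re = 0 := by
        refine (mul_eq_zero.1 (?_ : (φ ω).re * (φ ω).im = 0)).resolve_right hne
        linarith
      rw [this] at hre
      nlinarith [mul_self_nonneg (φ ω).im]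
    have him (x : K) : (φ (algebraMap K _ x)).im = 0 := by rw [hφx, Complex.ofReal_im]
    ext z
    have hz : z = algebraMap K _ z.re + algebraMap K _ z.im * ω := by
      ext <;> simp [algebraMap_eq]
    rw [ComplexEmbedding.conjugate_coe_eq, Complex.conj_eq_iff_im, hz, map_add, map_mul]
    simp [hω', him]

end QuadraticAlgebra

theorem Subgroup.relIndex_le_card {G X : Type*} [Group G] [Finite X] {H M : Subgroup G} (f : M → X)
    (hf : ∀ g g' : M, f g = f g' → (g : G)⁻¹ * g' ∈ H) : H.relIndex M ≤ Nat.card X := by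
  refine Nat.card_le_card_of_injective (fun q : M ⧸ H.subgroupOf M => f q.out) fun q q' h => ?_
  rw [← q.out_eq', ← q'.out_eq']
  exact QuotientGroup.eq.2 (hf _ _ h)

namespace NumberField

open IsDedekindDomain QuadraticAlgebra WithZero

section Units

variable (K : Type*) [Field K] [NumberField K]

variable {K} in
theorem one_ne_neg_one_units : (1 : (𝓞 K)ˣ) ≠ -1 := fun h => by
  have : (1 : 𝓞 K) = -1 := congrArg Units.val h
  norm_num [eq_neg_iff_add_eq_zero] at this

theorem card_ker_pow_two_units : Nat.card (powMonoidHom (α := (𝓞 K)ˣ) 2).ker = 2 := by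
  have : ((powMonoidHom (α := (𝓞 K)ˣ) 2).ker : Set (𝓞 K)ˣ) = {1, -1} := by
    ext x
    rw [SetLike.mem_coe, MonoidHom.mem_ker, powMonoidHom_apply, ← Units.val_inj,
      Units.val_pow_eq_pow_val, Units.val_one, sq_eq_one_iff]
    exact or_congr (Units.val_inj (a := x) (b := 1)) (Units.val_inj (a := x) (b := -1))
  rw [← SetLike.coe_sort_coe, this, Nat.card_coe_set_eq, Set.ncard_pair one_ne_neg_one_units]

variable {K} in
theorem two_le_card_ker_pow_two_ker {H : Type*} [CommGroup H] (N : (𝓞 K)ˣ →* H) (hN : N (-1) = 1) :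
    2 ≤ Nat.card (powMonoidHom (α := N.ker) 2).ker := by
  have hf : Finite (powMonoidHom (α := (𝓞 K)ˣ) 2).ker :=
    Nat.finite_of_card_ne_zero (by rw [card_ker_pow_two_units]; exact two_ne_zero)
  let f : (powMonoidHom (α := N.ker) 2).ker → (powMonoidHom (α := (𝓞 K)ˣ) 2).ker :=
    fun x => ⟨x.1.1, congrArg Subtype.val x.2⟩
  have : Finite (powMonoidHom (α := N.ker) 2).ker := Finite.of_injective f fun x y h =>
    Subtype.ext (Subtype.ext (congrArg (fun z => z.1) h))
  rw [Nat.succ_le_iff, Finite.one_lt_card_iff_nontrivial]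
  refine ⟨1, ⟨⟨-1, hN⟩, Subtype.ext neg_one_sq⟩, fun h => ?_⟩
  exact one_ne_neg_one_units (congrArg (fun x => x.1.1) h)

theorem finrank_units_add_one [IsTotallyReal K] :
    Module.finrank ℤ (Additive (𝓞 K)ˣ) + 1 = Module.finrank ℚ K := by
  have h0 : 0 < Module.finrank ℚ K := Module.finrank_pos
  rw [Units.finrank_eq, Units.rank, InfinitePlace.card_eq_nrRealPlaces_add_nrComplexPlaces,
    IsTotallyReal.nrComplexPlaces_eq_zero, ← IsTotallyReal.finrank]
  lia

theorem index_range_pow_two_units [IsTotallyReal K] :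
    (powMonoidHom (α := (𝓞 K)ˣ) 2).range.index = 2 ^ Module.finrank ℚ K := by
  rw [CommGroup.index_range_pow_two, card_ker_pow_two_units, ← pow_succ, finrank_units_add_one]

end Units

section Quadratic

variable {K : Type*} [Field K] [NumberField K]

/-- The quadratic algebra obtained from `K` by adjoining a square root of the unit `u`. -/
abbrev AdjoinSqrt (u : (𝓞 K)ˣ) : Type _ := QuadraticAlgebra K (u : K) 0

variable {u : (𝓞 K)ˣ}
  [Fact (∀ r : K, r ^ 2 ≠ (u : K) + 0 * r)]

theorem even_log_valuation_norm (p : HeightOneSpectrum (𝓞 K))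
    (hp : ∃ c : 𝓞 K, p.valuation K (algebraMap (𝓞 K) K (u - c ^ 2)) ≤ p.valuation K (4 : K))
    {α : AdjoinSqrt u} {ε : 𝓞 (AdjoinSqrt u)} (hα0 : α ≠ 0)
    (hα : α ^ 2 = algebraMap _ _ ε * algebraMap K _ α.norm) :
    Even (log (p.valuation K α.norm)) := by
  have hu : p.valuation K (u : K) = 1 := p.valuation_eq_one_iff_notMem.2 fun h =>
    p.isPrime.ne_top (Ideal.eq_top_of_isUnit_mem _ h u.isUnit)
  have hε := norm_eq_one_of_sq_eq hα0 hα
  by_cases hs : α.re = 0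
  · have h0 : α.im ≠ 0 := fun h => hα0 (by ext <;> simp [hs, h])
    have : α.norm = -(u * α.im ^ 2) := by rw [norm_eq_sub, hs]; ring
    rw [this, Valuation.map_neg, map_mul, hu, one_mul, map_pow, log_pow]
    exact ⟨_, two_nsmul _⟩
  · have hmul := norm_one_add_mul_norm hα0 hα
    have hs2 : 2 * α.re ≠ 0 := mul_ne_zero two_ne_zero hs
    have hn0 : (1 + (algebraMap _ _ ε : AdjoinSqrt u)).norm ≠ 0 := fun h =>
      pow_ne_zero 2 hs2 (by rw [← hmul, h, zero_mul])
    have hinteg : p.valuation K (1 + (algebraMap _ _ ε : AdjoinSqrt u)).norm ≤ 1 := by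
      have : (1 + (algebraMap _ _ ε : AdjoinSqrt u)).norm =
          algebraMap (𝓞 K) K (RingOfIntegers.norm K (1 + ε)) := by
        rw [← algebra_norm_eq_norm]
        exact (congrArg _ (by simp)).trans (RingOfIntegers.coe_norm K (1 + ε)).symm
      rw [this]
      exact p.valuation_le_one _
    rw [norm_one_add hε] at hn0 hinteg hmul
    obtain ⟨c, hc⟩ := hp
    have h4 : (4 : K) ≠ 0 := by norm_num
    have heven := Valuation.even_log_of_sq_mod_four (v := p.valuation K) (c := (c : K))
      (g := ((u : K) - c ^ 2) / 4)
        (b := (algebraMap (𝓞 (AdjoinSqrt u)) (AdjoinSqrt u) ε).im) hu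
      (p.valuation_le_one c) (by
        rw [map_div₀, div_le_one₀ (by simp [zero_lt_iff])]
        simpa using hc)
      (by simpa only [map_ofNat] using p.algebraMap_mem_filtration_zero (K := K) 4)
      (by field_simp; ring) (by rw [← norm_eq_sub, hε]) hinteg hn0
    have := congrArg (fun x => log (p.valuation K x)) hmul
    rw [map_mul, map_pow, log_mul (by simpa using hn0) (by simpa using norm_ne_zero hα0),
      log_pow] at this
    have h2 : Even (2 • log (p.valuation K (2 * α.re))) := ⟨_, two_nsmul _⟩
    rw [← this, Int.even_add] at h2
    exact h2.1 heven

theorem exists_units_sq_div_norm_eq [IsPrincipalIdealRing (𝓞 K)]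
    {α : AdjoinSqrt u} {ε : (𝓞 (AdjoinSqrt u))ˣ} (hα0 : α ≠ 0)
    (hα : α ^ 2 = algebraMap (𝓞 (AdjoinSqrt u)) _ ε * algebraMap K _ α.norm)
    (hev : ∀ p : HeightOneSpectrum (𝓞 K), Even (log (p.valuation K α.norm))) :
    ∃ β : (𝓞 (AdjoinSqrt u))ˣ,
      β ^ 2 / Units.map (algebraMap (𝓞 K) (𝓞 (AdjoinSqrt u))).toMonoidHom
        (Units.map (RingOfIntegers.norm K) β) = ε := by
  obtain ⟨η, w, hw, hη⟩ :=
    HeightOneSpectrum.exists_eq_units_mul_sq_of_even_log_valuation (norm_ne_zero hα0) hev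
  have hw' : algebraMap K (AdjoinSqrt u) w ≠ 0 := by simpa using hw
  let η' := Units.map (algebraMap (𝓞 K) (𝓞 (AdjoinSqrt u))).toMonoidHom η
  have hη' : algebraMap _ (AdjoinSqrt u) (η' : 𝓞 (AdjoinSqrt u)) =
      algebraMap K _ (η : K) := rfl
  let b : AdjoinSqrt u := α / algebraMap K _ w
  have hb : b ^ 2 = algebraMap (𝓞 (AdjoinSqrt u)) _ (ε * η' : (𝓞 (AdjoinSqrt u))ˣ) := by
    rw [div_pow, hα, hη, map_mul, map_pow, Units.val_mul, map_mul, hη']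
    field_simp
  have hbint : IsIntegral ℤ b := IsIntegral.of_pow two_pos (hb ▸ RingOfIntegers.isIntegral_coe _)
  obtain ⟨β, hβ⟩ : ∃ β : 𝓞 (AdjoinSqrt u), algebraMap _ (AdjoinSqrt u) β = b :=
    ⟨⟨b, hbint⟩, rfl⟩
  have hβ2 : β ^ 2 = (ε * η' : (𝓞 (AdjoinSqrt u))ˣ) := by
    apply RingOfIntegers.coe_injective
    rw [map_pow, hβ, hb]
  obtain ⟨β, rfl⟩ : IsUnit β := (isUnit_pow_iff two_ne_zero).1 (hβ2 ▸ Units.isUnit _)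
  have hN : Units.map (RingOfIntegers.norm K) β = η := by
    ext
    rw [Units.coe_map, RingOfIntegers.coe_norm, algebra_norm_eq_norm]
    change QuadraticAlgebra.norm (algebraMap (𝓞 (AdjoinSqrt u)) (AdjoinSqrt u) β) = (η : K)
    rw [hβ]
    have : b * algebraMap K _ w = α := div_mul_cancel₀ _ hw'
    have := congrArg QuadraticAlgebra.norm this
    rw [map_mul, QuadraticAlgebra.norm_algebraMap, hη] at this
    exact mul_right_cancel₀ (pow_ne_zero 2 hw) this
  refine ⟨β, ?_⟩
  rw [hN, div_eq_iff_eq_mul]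
  exact Units.ext hβ2

/-- The index of the image of `β ↦ β ^ 2 / norm β` in the relative units is at most `2 ^ #T`, if
`u` is locally a square modulo `4` outside `T`. -/
theorem relIndex_range_sq_div_norm_le [IsPrincipalIdealRing (𝓞 K)]
    (T : Finset (HeightOneSpectrum (𝓞 K))) (hT : ∀ p ∉ T, ∃ c : 𝓞 K,
      p.valuation K (algebraMap (𝓞 K) K (u - c ^ 2)) ≤ p.valuation K (4 : K))
    (ψ : (𝓞 (AdjoinSqrt u))ˣ →* (𝓞 (AdjoinSqrt u))ˣ)
    (hψ : ∀ β, ψ β =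
      β ^ 2 / Units.map (algebraMap (𝓞 K) (𝓞 (AdjoinSqrt u))).toMonoidHom
        (Units.map (RingOfIntegers.norm K) β)) :
    ψ.range.relIndex (Units.map (RingOfIntegers.norm K)).ker ≤ 2 ^ T.card := by
  classical
  have hker (ε : (Units.map (RingOfIntegers.norm (L := AdjoinSqrt u) K)).ker) :
      (algebraMap _ (AdjoinSqrt u) (ε.1 : 𝓞 (AdjoinSqrt u))).norm = 1 := by
    have h := congrArg (fun x : (𝓞 K)ˣ => (x : K)) (MonoidHom.mem_ker.1 ε.2)
    simpa [← algebra_norm_eq_norm] using h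
  choose α hα0 hα using fun ε => exists_sq_eq_mul_norm (hker ε)
  have := Subgroup.relIndex_le_card (H := ψ.range)
    (fun ε => fun p : T => decide (Even (log (p.1.valuation K (α ε).norm)))) fun ε ε' h => ?_
  · simpa using this
  have h0 : α ε' / α ε ≠ 0 := div_ne_zero (hα0 _) (hα0 _)
  have hnorm : (α ε' / α ε).norm = (α ε').norm / (α ε).norm := by
    rw [eq_div_iff (norm_ne_zero (hα0 _)), ← map_mul, div_mul_cancel₀ _ (hα0 _)]
  have hn := fun ε => norm_ne_zero (hα0 ε)
  have hdiv : (α ε' / α ε) ^ 2 = algebraMap (𝓞 (AdjoinSqrt u)) _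
      (ε.1⁻¹ * ε'.1 : (𝓞 (AdjoinSqrt u))ˣ) * algebraMap K _ (α ε' / α ε).norm := by
    have hinv : algebraMap _ (AdjoinSqrt u) ((ε.1⁻¹ : (𝓞 (AdjoinSqrt u))ˣ) : 𝓞 (AdjoinSqrt u)) =
        (algebraMap _ (AdjoinSqrt u) (ε.1 : 𝓞 (AdjoinSqrt u)))⁻¹ := by
      exact eq_inv_of_mul_eq_one_left (by rw [← map_mul, Units.inv_mul, map_one])
    rw [hnorm, div_pow, hα, hα, Units.val_mul, map_mul, hinv, map_div₀]
    field_simp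
  obtain ⟨β, hβ⟩ := exists_units_sq_div_norm_eq h0 hdiv fun p => by
    by_cases hp : p ∈ T
    · have := congrFun h ⟨p, hp⟩
      simp only [decide_eq_decide] at this
      rw [hnorm, map_div₀, log_div (by simpa using hn _) (by simpa using hn _), Int.even_sub, this]
    · exact even_log_valuation_norm p (hT p hp) h0 hdiv
  exact ⟨β, (hψ β).trans hβ⟩

end Quadratic

end NumberField

/-- If `K` is totally real with class number one and the units of `𝓞 K` surject onto the units
modulo `4`, then no quadratic extension of `K` by the square root of a unit is totally real. -/
theorem NumberField.not_isTotallyReal_adjoinSqrt {K : Type*} [Field K] [NumberField K]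
    [IsTotallyReal K] [IsPrincipalIdealRing (𝓞 K)]
    (hsurj : Function.Surjective
      (Units.map (Ideal.Quotient.mk (Ideal.span {(4 : 𝓞 K)})).toMonoidHom))
    (u : (𝓞 K)ˣ) [Fact (∀ r : K, r ^ 2 ≠ (u : K) + 0 * r)] : ¬ IsTotallyReal (AdjoinSqrt u) := by
  intro hL
  let N : (𝓞 (AdjoinSqrt u))ˣ →* (𝓞 K)ˣ := Units.map (RingOfIntegers.norm K)
  let ι : (𝓞 K)ˣ →* (𝓞 (AdjoinSqrt u))ˣ :=
    Units.map (algebraMap (𝓞 K) (𝓞 (AdjoinSqrt u))).toMonoidHom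
  have hι (z : (𝓞 K)ˣ) : N (ι z) = z ^ 2 := Units.ext <|
    (RingOfIntegers.norm_algebraMap K (z : 𝓞 K)).trans (by
      rw [QuadraticAlgebra.finrank_eq_two, Units.val_pow_eq_pow_val])
  have hN : N (-1) = 1 := by
    have : ι (-1) = -1 := Units.ext (by simp [ι])
    rw [← this, hι, neg_one_sq]
  have hE := index_range_pow_two_units K
  have hE0 : (powMonoidHom (α := (𝓞 K)ˣ) 2).range.index ≠ 0 := hE ▸ pow_ne_zero _ two_ne_zero
  have hfin : {p : IsDedekindDomain.HeightOneSpectrum (𝓞 K) | (2 : 𝓞 K) ∈ p.asIdeal ∧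
      ∀ c : 𝓞 K, ¬ p.valuation K (algebraMap (𝓞 K) K (u - c ^ 2)) ≤
        p.valuation K (4 : K)}.Finite :=
    (IsDedekindDomain.HeightOneSpectrum.finite_setOf_mem two_ne_zero).subset fun p hp => hp.1
  have hupper := relIndex_range_sq_div_norm_le (u := u) hfin.toFinset (fun p hp => by
    by_cases h2 : (2 : 𝓞 K) ∈ p.asIdeal
    · by_contra! hc
      exact hp (hfin.mem_toFinset.2 ⟨h2, fun c => (hc c).not_ge⟩)
    · refine ⟨0, (p.valuation_le_one _).trans_eq ?_⟩
      have h4 : (4 : 𝓞 K) ∉ p.asIdeal := fun h => h2 <| p.isPrime.mem_of_pow_mem 2 <| by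
        convert h using 1
        norm_num
      rw [← map_ofNat (algebraMap (𝓞 K) K) 4, p.valuation_eq_one_iff_notMem.2 h4])
    (powMonoidHom 2 / ι.comp N) fun β => rfl
  have hlower : 2 ^ hfin.toFinset.card ≤ N.range.index := by
    refine IsDedekindDomain.HeightOneSpectrum.two_pow_card_le_index (by norm_num) hsurj K _ _
      (ne_zero_of_dvd_ne_zero hE0 (Subgroup.index_dvd_of_le ?_)) fun p hp => ?_
    · rintro _ ⟨z, rfl⟩
      exact ⟨ι z, hι z⟩
    rw [Set.Finite.mem_toFinset] at hp
    have : p.asIdeal.IsMaximal := p.isMaximal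
    obtain ⟨η, hη, h⟩ := p.exists_not_norm_mod_four (K := K) hp.1
      (fun h => p.isPrime.ne_top (Ideal.eq_top_of_isUnit_mem _ h u.isUnit)) hp.2
    refine ⟨by convert Ideal.mul_mem_left _ 2 hp.1 using 1; norm_num, η, hη, ?_⟩
    rintro _ ⟨β, rfl⟩
    have hβ : algebraMap (𝓞 K) K (N β) = (algebraMap (𝓞 (AdjoinSqrt u)) (AdjoinSqrt u) β).norm := by
      rw [← QuadraticAlgebra.algebra_norm_eq_norm]
      exact RingOfIntegers.coe_norm K _
    rw [map_sub, hβ, QuadraticAlgebra.norm_eq_sub, map_ofNat]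
    exact h _ _
  have hindex := Subgroup.index_sq_ker_mul_index_range_le N ι hι (powMonoidHom 2 / ι.comp N)
    (fun _ => rfl) hE0
  have := CommGroup.finite_additive_ker N
  have hrank := CommGroup.finrank_le_finrank_add_finrank_ker N
  have hK := finrank_units_add_one K
  have hL := finrank_units_add_one (AdjoinSqrt u)
  rw [QuadraticAlgebra.finrank_rat] at hL
  have hker : 2 ^ Module.finrank ℚ K * 2 ≤ (powMonoidHom (α := N.ker) 2).range.index := by
    rw [CommGroup.index_range_pow_two]
    gcongr
    · exact one_le_two
    · lia
    · exact two_le_card_ker_pow_two_ker N hN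
  rw [hE] at hindex
  have hle := (Nat.mul_le_mul hker hlower).trans (hindex.trans (Nat.mul_le_mul_left _ hupper))
  have hpos : 0 < 2 ^ Module.finrank ℚ K * 2 ^ hfin.toFinset.card := by positivity
  nlinarith

/-- **Part of Theorem 17 of Kraus' paper (converse direction).**
Let `K` be a totally real number field with class number `1` such that the reduction
map `(𝓞 K)ˣ → (𝓞 K / 4𝓞 K)ˣ` is surjective.  Then every totally positive unit of
`𝓞 K` is a square in `𝓞 K`. -/
theorem totally_positive_unit_is_square_of_units_map_surjective
    (K : Type*) [Field K] [NumberField K]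
    (htotreal : ∀ φ : K →+* ℂ, ∀ x : K, (φ x).im = 0)
    (hclass : NumberField.classNumber K = 1)
    (hsurj : Function.Surjective
      (Units.map (Ideal.Quotient.mk (Ideal.span {(4 : 𝓞 K)})).toMonoidHom :
        (𝓞 K)ˣ → ((𝓞 K) ⧸ Ideal.span {(4 : 𝓞 K)})ˣ)) :
    ∀ u : (𝓞 K)ˣ,
      (∀ σ : K →+* ℝ, 0 < σ (algebraMap (𝓞 K) K u)) → ∃ w : 𝓞 K, (u : 𝓞 K) = w ^ 2 := by
  intro u hu
  have : IsTotallyReal K := ⟨fun v => by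
    rw [InfinitePlace.isReal_iff, ComplexEmbedding.isReal_iff]
    ext x
    rw [ComplexEmbedding.conjugate_coe_eq, Complex.conj_eq_iff_im]
    exact htotreal _ x⟩
  have : IsPrincipalIdealRing (𝓞 K) := classNumber_eq_one_iff.1 hclass
  by_contra hsq
  have : Fact (∀ r : K, r ^ 2 ≠ (u : K) + 0 * r) := ⟨fun r hr => hsq <| by
    rw [zero_mul, add_zero] at hr
    have hinteg : IsIntegral ℤ r :=
      IsIntegral.of_pow two_pos (hr ▸ RingOfIntegers.isIntegral_coe _)
    exact ⟨⟨r, hinteg⟩, RingOfIntegers.coe_injective hr.symm⟩⟩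
  exact not_isTotallyReal_adjoinSqrt hsurj u (QuadraticAlgebra.isTotallyReal hu)
end
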